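/- For each N ≥ 1, let X_N = U_N D_N U_N^* be an N×N Hermitian random matrix, where U_N is Haar-distributed on the unitary group U(N) and D_N is a random real diagonal matrix independent of U_N. Let λ_1^{(N)} ≤ ⋯ ≤ λ_N^{(N)} be the eigenvalues of X_N, let m_N = (1/N) Σ_{i=1}^N δ_{λ_i^{(N)}} be the empirical eigenvalue distribution, and let λ̃_1^{(N)} ≤ ⋯ ≤ λ̃_{N−1}^{(N)} be the eigenvalues of the principal submatrix X̃_N obtained by deleting the last row and column of X_N. Set M_k(κ_N) = Σ_{i=1}^N (λ_i^{(N)})^k − Σ_{j=1}^{N−1} (λ̃_j^{(N)})^k and M_k(τ_N) = Σ_{ρ ∈ NC(k)} (k + 1 − |ρ|) fc_ρ(m_N). Assume that sup_{N≥1} E[M_k(m_N)] < ∞ for every even k. Then for every k ≥ 1, E[M_k(κ_N)^2] = E[M_k(τ_N)^2] + O(1/N) as N → ∞, i.e., there is a constant C (depending on k) with |E[M_k(κ_N)^2] − E[M_k(τ_N)^2]| ≤ C/N for all N. -/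

import Mathlib

open MeasureTheory ProbabilityTheory Finset
open scoped Classical

/-- Measurable structure on matrices (entrywise, i.e. the product σ-algebra). -/
instance matrixMeasurableSpace {m n α : Type*} [MeasurableSpace α] :
    MeasurableSpace (Matrix m n α) :=
  inferInstanceAs (MeasurableSpace (m → n → α))

/-- `ρ` is a partition of the finite set `S ⊆ ℕ`: its blocks are nonempty subsets of `S`
and every element of `S` lies in exactly one block. -/
def IsPartitionOn (S : Finset ℕ) (ρ : Finset (Finset ℕ)) : Prop :=
  (∀ B ∈ ρ, B.Nonempty) ∧ (∀ B ∈ ρ, B ⊆ S) ∧ (∀ x ∈ S, ∃! B, B ∈ ρ ∧ x ∈ B)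

/-- A family of blocks is non-crossing if no two distinct blocks cross. -/
def IsNoncrossing (ρ : Finset (Finset ℕ)) : Prop :=
  ∀ B ∈ ρ, ∀ C ∈ ρ, B ≠ C →
    ¬ ∃ a b c d : ℕ, a ∈ B ∧ b ∈ B ∧ c ∈ C ∧ d ∈ C ∧ a < c ∧ c < b ∧ b < d

/-- `ρ` is a non-crossing partition of `S`. -/
def IsNCPartitionOn (S : Finset ℕ) (ρ : Finset (Finset ℕ)) : Prop :=
  IsPartitionOn S ρ ∧ IsNoncrossing ρ

/-- `NC(k)`: the finite set of all non-crossing partitions of `{1, …, k}`. -/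
noncomputable def NCFinset (k : ℕ) : Finset (Finset (Finset ℕ)) :=
  ((Finset.Icc 1 k).powerset.powerset).filter (IsNCPartitionOn (Finset.Icc 1 k))


/-- `x` and `y` are related by Newton's identities `∑_{i<k} x_i y_{k-i} = k x_k`, `x_0 = 1`. -/
def IsNewtonPair (x y : ℕ → ℝ) : Prop :=
  x 0 = 1 ∧ ∀ k, ∑ p ∈ Finset.HasAntidiagonal.antidiagonal k, x p.1 * y (p.2 + 1) = (k + 1) * x (k + 1)

theorem sum_smul_compression_pow {R A : Type*} [CommRing R] [Ring A] [Algebra R A]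
    (X E : A) (v : ℕ → R) (hv : v 0 = 1) (hE : ∀ j, E * X ^ j * E = v j • E) (k : ℕ) :
    ∑ p ∈ Finset.HasAntidiagonal.antidiagonal (k + 1), v p.1 • (X * (1 - E)) ^ p.2 =
      ∑ p ∈ Finset.HasAntidiagonal.antidiagonal (k + 1), v p.1 • X ^ p.2 -
        ∑ p ∈ Finset.HasAntidiagonal.antidiagonal k, X ^ (p.1 + 1) * E * X ^ p.2 := by
  induction k with
  | zero =>
    simp [Finset.Nat.antidiagonal_succ, hv, mul_sub]
    abel
  | succ k ih =>
    have key : ∀ Y : A, ∑ p ∈ Finset.HasAntidiagonal.antidiagonal (k + 2), v p.1 • Y ^ p.2 =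
        v (k + 2) • 1 + (∑ p ∈ Finset.HasAntidiagonal.antidiagonal (k + 1), v p.1 • Y ^ p.2) * Y := by
      intro Y
      rw [Finset.Nat.sum_antidiagonal_succ', Finset.sum_mul]
      simp [pow_succ]
    have h1 : (∑ p ∈ Finset.HasAntidiagonal.antidiagonal (k + 1), v p.1 • X ^ p.2) * X * E =
        X ^ (k + 2) * E + ∑ p ∈ Finset.HasAntidiagonal.antidiagonal k, v (p.1 + 1) • (X ^ (p.2 + 1) * E) := by
      rw [Finset.Nat.sum_antidiagonal_succ, add_mul, add_mul, Finset.sum_mul, Finset.sum_mul]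
      simp [hv, pow_succ]
    have h2 : (∑ p ∈ Finset.HasAntidiagonal.antidiagonal k, X ^ (p.1 + 1) * E * X ^ p.2) * X * E =
        ∑ p ∈ Finset.HasAntidiagonal.antidiagonal k, v (p.1 + 1) • (X ^ (p.2 + 1) * E) := by
      rw [← Finset.Nat.sum_antidiagonal_swap, Finset.sum_mul, Finset.sum_mul]
      refine Finset.sum_congr rfl fun p _ => ?_
      rw [← mul_smul_comm, ← hE]
      simp [pow_succ, mul_assoc]
    have h3 : ∑ p ∈ Finset.HasAntidiagonal.antidiagonal (k + 1), X ^ (p.1 + 1) * E * X ^ p.2 =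
        X ^ (k + 2) * E + (∑ p ∈ Finset.HasAntidiagonal.antidiagonal k, X ^ (p.1 + 1) * E * X ^ p.2) * X := by
      rw [Finset.Nat.sum_antidiagonal_succ', Finset.sum_mul]
      simp [pow_succ, mul_assoc]
    rw [key, key, ih, h3]
    have : ∀ K T : A, (K - T) * (X * (1 - E)) = K * X - T * X - (K * X * E - T * X * E) := by
      intro K T; noncomm_ring
    rw [this, h1, h2]
    abel

theorem trace_submatrix_castSucc_pow {n : ℕ} (X : Matrix (Fin (n + 1)) (Fin (n + 1)) ℂ) (j : ℕ) :
    ((X.submatrix Fin.castSucc Fin.castSucc) ^ (j + 1)).trace =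
      ((X * (1 - Matrix.single (Fin.last n) (Fin.last n) (1 : ℂ))) ^ (j + 1)).trace := by
  set J : Matrix (Fin (n + 1)) (Fin n) ℂ :=
    (1 : Matrix (Fin (n + 1)) (Fin (n + 1)) ℂ).submatrix id Fin.castSucc with hJ
  have h1 : X.submatrix Fin.castSucc Fin.castSucc = J.transpose * (X * J) := by
    ext a b
    simp [J, Matrix.mul_apply, Matrix.one_apply]
  have h2 : J * J.transpose = 1 - Matrix.single (Fin.last n) (Fin.last n) (1 : ℂ) := by
    ext a b
    refine Fin.lastCases ?_ (fun a => ?_) a <;> refine Fin.lastCases ?_ (fun b => ?_) b <;>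
    simp [J, Matrix.mul_apply, Matrix.one_apply, Matrix.single, Fin.ext_iff, (Fin.is_lt _).ne, (Fin.is_lt _).ne']
    simp [← Fin.ext_iff, eq_comm]
  have h3 : ∀ j : ℕ, (J.transpose * (X * J)) ^ (j + 1) =
      J.transpose * ((X * (J * J.transpose)) ^ j * (X * J)) := by
    intro j
    induction j with
    | zero => simp
    | succ j ih => rw [pow_succ, ih, pow_succ]; simp only [Matrix.mul_assoc]
  rw [h1, h3, Matrix.trace_mul_comm, ← h2, pow_succ]
  simp only [Matrix.mul_assoc]

theorem newton_corner {n : ℕ} (X : Matrix (Fin (n + 1)) (Fin (n + 1)) ℂ) (k : ℕ) :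
    ∑ p ∈ Finset.HasAntidiagonal.antidiagonal k, (X ^ p.1) (Fin.last n) (Fin.last n) *
      ((X ^ (p.2 + 1)).trace - ((X.submatrix Fin.castSucc Fin.castSucc) ^ (p.2 + 1)).trace) =
      (k + 1) * (X ^ (k + 1)) (Fin.last n) (Fin.last n) := by
  set E := Matrix.single (Fin.last n) (Fin.last n) (1 : ℂ) with hE
  have h := sum_smul_compression_pow X E (fun j => (X ^ j) (Fin.last n) (Fin.last n))
    (by simp) (fun j => by ext a b; simp [E]; simp [Matrix.single_apply]) k
  have h' := congrArg Matrix.trace h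
  simp only [Matrix.trace_sub, Matrix.trace_sum, Matrix.trace_smul, smul_eq_mul] at h'
  rw [Finset.Nat.sum_antidiagonal_succ', Finset.Nat.sum_antidiagonal_succ'] at h'
  have h4 : ∀ p ∈ Finset.HasAntidiagonal.antidiagonal k, (X ^ (p.1 + 1) * E * X ^ p.2).trace =
      (X ^ (k + 1)) (Fin.last n) (Fin.last n) := by
    intro p hp
    rw [Matrix.trace_mul_comm, ← Matrix.mul_assoc, ← pow_add, Matrix.trace_mul_comm]
    have : p.2 + (p.1 + 1) = k + 1 := by have := Finset.HasAntidiagonal.mem_antidiagonal.1 hp; omega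
    rw [this, hE, Matrix.trace_single_mul]
    simp
  rw [Finset.sum_congr rfl h4] at h'
  simp only [trace_submatrix_castSucc_pow, ← hE]
  simp only [mul_sub _ (Matrix.trace _), Finset.sum_sub_distrib]
  simp only [pow_zero, Finset.sum_const, Finset.Nat.card_antidiagonal, nsmul_eq_mul] at h'
  push_cast at h'
  linear_combination -h'

theorem isNCPartitionOn_iff {S : Finset ℕ} {ρ : Finset (Finset ℕ)} :
    IsNCPartitionOn S ρ ↔ (∀ B ∈ ρ, ∃ x, x ∈ B) ∧ (∀ B ∈ ρ, ∀ x ∈ B, x ∈ S) ∧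
      (∀ x ∈ S, ∃ B ∈ ρ, x ∈ B) ∧ (∀ B ∈ ρ, ∀ C ∈ ρ, ∀ x, x ∈ B → x ∈ C → B = C) ∧
      (∀ B ∈ ρ, ∀ C ∈ ρ, ∀ a c b d, a ∈ B → b ∈ B → c ∈ C → d ∈ C → a < c → c < b → b < d →
        B = C) := by
  constructor
  · rintro ⟨⟨h1, h2, h3⟩, h4⟩
    refine ⟨h1, h2, fun x hx => ?_, fun B hB C hC x hxB hxC => ?_, ?_⟩
    · obtain ⟨B, hB, -⟩ := h3 x hx
      exact ⟨B, hB⟩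
    · exact (h3 x (h2 B hB hxB)).unique ⟨hB, hxB⟩ ⟨hC, hxC⟩
    · intro B hB C hC a c b d ha hb hc hd h5 h6 h7
      by_contra hne
      exact h4 B hB C hC hne ⟨a, b, c, d, ha, hb, hc, hd, h5, h6, h7⟩
  · rintro ⟨h1, h2, h3, h4, h5⟩
    refine ⟨⟨h1, h2, fun x hx => ?_⟩, ?_⟩
    · obtain ⟨B, hB, hx⟩ := h3 x hx
      exact ⟨B, ⟨hB, hx⟩, fun C hC => h4 C hC.1 B hB x hC.2 hx⟩
    · rintro B hB C hC hne ⟨a, b, c, d, ha, hb, hc, hd, h6, h7, h8⟩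
      exact hne (h5 B hB C hC a c b d ha hb hc hd h6 h7 h8)

/-- The non-crossing partitions of a finite set of natural numbers. -/
noncomputable def ncOn (S : Finset ℕ) : Finset (Finset (Finset ℕ)) :=
  S.powerset.powerset.filter (IsNCPartitionOn S)

theorem mem_ncOn {S : Finset ℕ} {ρ : Finset (Finset ℕ)} : ρ ∈ ncOn S ↔ IsNCPartitionOn S ρ := by
  simp only [ncOn, Finset.mem_filter, Finset.mem_powerset, and_iff_right_iff_imp]
  intro h B hB
  exact Finset.mem_powerset.2 (h.1.2.1 B hB)

/-- The weight `∏ c_{|B|}` of a partition, where `s` is added to the size of the block of `q`. -/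
noncomputable def blockWeight {R : Type*} [CommRing R] (c : ℕ → R) (s q : ℕ)
    (ρ : Finset (Finset ℕ)) : R :=
  ∏ B ∈ ρ, c (if q ∈ B then B.card + s else B.card)

/-- Glue a block structure on `[a, p]` and one on `[p + 1, b - 1]`, adding `b` to the block
of `p`. -/
noncomputable def ncGlue (p b : ℕ) (ρ : Finset (Finset ℕ) × Finset (Finset ℕ)) :
    Finset (Finset ℕ) :=
  ρ.2 ∪ ρ.1.image (fun B => if p ∈ B then insert b B else B)

/-- The inverse of `ncGlue`. -/
noncomputable def ncSplit (a p b : ℕ) (ρ : Finset (Finset ℕ)) :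
    Finset (Finset ℕ) × Finset (Finset ℕ) :=
  ((ρ.image (fun B => B.erase b)).filter (· ⊆ Finset.Ico a (p + 1)),
    ρ.filter (· ⊆ Finset.Ico (p + 1) b))

/-- `p` is the predecessor of `b` in the block of `b`, where `b` is the largest element. -/
def IsPrevOf (p b : ℕ) (ρ : Finset (Finset ℕ)) : Prop :=
  ∃ B ∈ ρ, b ∈ B ∧ p ∈ B ∧ ∀ x ∈ B, x ≤ p ∨ x = b

theorem ncGlue_mem {a p b : ℕ} (hap : a ≤ p) (hpb : p < b)
    {ρ₁ ρ₂ : Finset (Finset ℕ)} (h₁ : ρ₁ ∈ ncOn (Finset.Ico a (p + 1)))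
    (h₂ : ρ₂ ∈ ncOn (Finset.Ico (p + 1) b)) :
    ncGlue p b (ρ₁, ρ₂) ∈ ncOn (Finset.Ico a (b + 1)) ∧ IsPrevOf p b (ncGlue p b (ρ₁, ρ₂)) := by
  rw [mem_ncOn, isNCPartitionOn_iff] at h₁ h₂
  obtain ⟨a1, a2, a3, a4, a5⟩ := h₁
  obtain ⟨b1, b2, b3, b4, b5⟩ := h₂
  simp only [Finset.mem_Ico] at a2 a3 b2 b3
  have hmem : ∀ B, B ∈ ncGlue p b (ρ₁, ρ₂) ↔ B ∈ ρ₂ ∨ ∃ C ∈ ρ₁, (∀ x, x ∈ B ↔ (x ∈ C ∨ (x = b ∧ p ∈ C))) := by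
    intro B
    simp only [ncGlue, Finset.mem_union, Finset.mem_image]
    refine or_congr Iff.rfl (exists_congr fun C => and_congr Iff.rfl ?_)
    rw [eq_comm, Finset.ext_iff]
    refine forall_congr' fun x => ?_
    split_ifs with h <;> simp [h, or_comm]
  have hloc : ∀ B ∈ ncGlue p b (ρ₁, ρ₂), (B ∈ ρ₂ ∧ ∀ x ∈ B, p < x ∧ x < b) ∨
      ∃ C ∈ ρ₁, (∀ x, x ∈ B ↔ (x ∈ C ∨ (x = b ∧ p ∈ C))) ∧ ∀ x ∈ B, (a ≤ x ∧ x ≤ p) ∨ (x = b ∧ p ∈ C) := by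
    intro B hB
    rcases (hmem B).1 hB with h | ⟨C, hC, h⟩
    · exact Or.inl ⟨h, fun x hx => by have := b2 B h x hx; omega⟩
    · refine Or.inr ⟨C, hC, h, fun x hx => ?_⟩
      rcases (h x).1 hx with h | h
      · have := a2 C hC x h; omega
      · exact Or.inr h
  refine ⟨?_, ?_⟩
  · rw [mem_ncOn, isNCPartitionOn_iff]
    refine ⟨?_, ?_, ?_, ?_, ?_⟩
    · intro B hB
      rcases hloc B hB with ⟨h, -⟩ | ⟨C, hC, h, -⟩
      · exact b1 B h
      · obtain ⟨x, hx⟩ := a1 C hC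
        exact ⟨x, (h x).2 (Or.inl hx)⟩
    · intro B hB x hx
      rw [Finset.mem_Ico]
      rcases hloc B hB with ⟨-, h⟩ | ⟨C, hC, -, h⟩
      · have := h x hx; omega
      · have := h x hx; omega
    · intro x hx
      rw [Finset.mem_Ico] at hx
      by_cases hxp : x ≤ p
      · obtain ⟨C, hC, hxC⟩ := a3 x (by omega)
        refine ⟨if p ∈ C then insert b C else C, ?_, ?_⟩
        · exact Finset.mem_union_right _ (Finset.mem_image_of_mem _ hC)
        · split_ifs <;> simp [hxC]
      by_cases hxb : x < b
      · obtain ⟨C, hC, hxC⟩ := b3 x (by omega)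
        exact ⟨C, Finset.mem_union_left _ hC, hxC⟩
      · obtain ⟨C, hC, hxC⟩ := a3 p (by omega)
        refine ⟨if p ∈ C then insert b C else C, ?_, ?_⟩
        · exact Finset.mem_union_right _ (Finset.mem_image_of_mem _ hC)
        · rw [if_pos hxC, Finset.mem_insert]; left; omega
    · intro B hB C hC x hxB hxC
      rcases hloc B hB with ⟨hB', h⟩ | ⟨B', hB', hBB, h⟩ <;>
        rcases hloc C hC with ⟨hC', k⟩ | ⟨C', hC', hCC, k⟩
      · exact b4 B hB' C hC' x hxB hxC
      · have := h x hxB; have := k x hxC; omega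
      · have := h x hxB; have := k x hxC; omega
      · have : B' = C' := by
          by_cases hx : x = b
          · have h1 := h x hxB
            have h2 := k x hxC
            exact a4 B' hB' C' hC' p (by rcases h1 with h1 | h1; · omega
                                         · exact h1.2) (by rcases h2 with h1 | h1; · omega
                                                           · exact h1.2)
          · exact a4 B' hB' C' hC' x (by have := (hBB x).1 hxB; tauto)
              (by have := (hCC x).1 hxC; tauto)
        subst this
        ext y
        rw [hBB, hCC]
    · intro B hB C hC x y z w hx hz hy hw hxy hyz hzw
      rcases hloc B hB with ⟨hB', h⟩ | ⟨B', hB', hBB, h⟩ <;>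
        rcases hloc C hC with ⟨hC', k⟩ | ⟨C', hC', hCC, k⟩
      · exact b5 B hB' C hC' x y z w hx hz hy hw hxy hyz hzw
      · have := h x hx; have := h z hz; have := k y hy; have := k w hw; omega
      · have := h x hx; have := h z hz; have := k y hy; have := k w hw; omega
      · have e1 := h x hx; have e2 := h z hz; have e3 := k y hy; have e4 := k w hw
        have f1 : x ∈ B' := by have := (hBB x).1 hx; rcases this with h | h; · exact h
                               · omega
        have f2 : z ∈ B' := by have := (hBB z).1 hz; rcases this with h | h; · exact h
                               · omega
        have f3 : y ∈ C' := by have := (hCC y).1 hy; rcases this with h | h; · exact h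
                               · omega
        have : B' = C' := by
          rcases (hCC w).1 hw with h | ⟨h, h'⟩
          · exact a5 B' hB' C' hC' x y z w f1 f2 f3 h hxy hyz hzw
          · by_cases hzp : z = p
            · subst hzp; exact a4 B' hB' C' hC' z f2 h'
            · exact a5 B' hB' C' hC' x y z p f1 f2 f3 h' hxy hyz (by omega)
        subst this
        ext y
        rw [hBB, hCC]
  · obtain ⟨C, hC, hpC⟩ := a3 p (by omega)
    refine ⟨insert b C, ?_, by simp, by simp [hpC], ?_⟩
    · have := Finset.mem_image_of_mem (fun B => if p ∈ B then insert b B else B) hC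
      simp only [if_pos hpC] at this
      exact Finset.mem_union_right _ this
    · intro x hx
      rcases Finset.mem_insert.1 hx with h | h
      · exact Or.inr h
      · left; have := a2 C hC x h; omega

theorem ncOn_dichotomy {a p b : ℕ}
    {ρ : Finset (Finset ℕ)} (h : ρ ∈ ncOn (Finset.Ico a (b + 1))) (hp : IsPrevOf p b ρ)
    {C : Finset ℕ} (hC : C ∈ ρ) :
    (∀ x ∈ C, p < x ∧ x < b) ∨ ((∀ x ∈ C, (a ≤ x ∧ x ≤ p) ∨ x = b) ∧ (b ∈ C ↔ p ∈ C)) := by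
  rw [mem_ncOn, isNCPartitionOn_iff] at h
  obtain ⟨a1, a2, a3, a4, a5⟩ := h
  obtain ⟨B, hB, hbB, hpB, hx⟩ := hp
  simp only [Finset.mem_Ico] at a2 a3
  by_cases hCB : C = B
  · subst hCB
    right
    exact ⟨fun x hxC => by have := hx x hxC; have := a2 C hC x hxC; omega, by tauto⟩
  · have hbC : b ∉ C := fun h => hCB (a4 C hC B hB b h hbB)
    have hpC : p ∉ C := fun h => hCB (a4 C hC B hB p h hpB)
    by_cases hex : ∃ c ∈ C, c ≤ p
    · right
      obtain ⟨c, hc, hcp⟩ := hex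
      refine ⟨fun d hd => ?_, by tauto⟩
      by_contra hd'
      have h1 := a2 C hC d hd
      have h2 : c ≠ p := fun h => hpC (h ▸ hc)
      exact hCB (a5 C hC B hB c p d b hc hd hpB hbB (by omega) (by omega) (by omega))
    · left
      push Not at hex
      intro x hxC
      have h1 := a2 C hC x hxC
      have h2 := hex x hxC
      have h3 : x ≠ b := fun h => hbC (h ▸ hxC)
      omega

theorem ncSplit_mem {a p b : ℕ} (hap : a ≤ p) (hpb : p < b)
    {ρ : Finset (Finset ℕ)} (h : ρ ∈ ncOn (Finset.Ico a (b + 1))) (hp : IsPrevOf p b ρ) :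
    (ncSplit a p b ρ).1 ∈ ncOn (Finset.Ico a (p + 1)) ∧
      (ncSplit a p b ρ).2 ∈ ncOn (Finset.Ico (p + 1) b) := by
  have hd := fun C hC => ncOn_dichotomy h hp (C := C) hC
  rw [mem_ncOn, isNCPartitionOn_iff] at h
  obtain ⟨a1, a2, a3, a4, a5⟩ := h
  simp only [Finset.mem_Ico] at a2 a3
  have m1 : ∀ B ∈ (ncSplit a p b ρ).1, (∃ C ∈ ρ, (∀ x, x ∈ B ↔ x ∈ C ∧ x ≠ b) ∧ C.erase b = B) ∧
      ∀ x ∈ B, a ≤ x ∧ x < p + 1 := by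
    intro B hB
    simp only [ncSplit, Finset.mem_filter, Finset.mem_image] at hB
    obtain ⟨⟨C, hC, rfl⟩, hs⟩ := hB
    exact ⟨⟨C, hC, fun x => by rw [Finset.mem_erase, and_comm], rfl⟩,
      fun x hx => Finset.mem_Ico.1 (hs hx)⟩
  have m2 : ∀ B ∈ (ncSplit a p b ρ).2, B ∈ ρ ∧ ∀ x ∈ B, p + 1 ≤ x ∧ x < b := by
    intro B hB
    simp only [ncSplit, Finset.mem_filter] at hB
    exact ⟨hB.1, fun x hx => Finset.mem_Ico.1 (hB.2 hx)⟩
  simp only [mem_ncOn, isNCPartitionOn_iff, Finset.mem_Ico]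
  refine ⟨⟨?_, ?_, ?_, ?_, ?_⟩, ?_, ?_, ?_, ?_, ?_⟩
  · intro B hB
    obtain ⟨⟨C, hC, hBC, -⟩, hs⟩ := m1 B hB
    obtain ⟨x, hx⟩ := a1 C hC
    by_cases hxb : x = b
    · subst hxb
      rcases hd C hC with h | ⟨h, h'⟩
      · have := h x hx; omega
      · exact ⟨p, (hBC p).2 ⟨h'.1 hx, by omega⟩⟩
    · exact ⟨x, (hBC x).2 ⟨hx, hxb⟩⟩
  · exact fun B hB => (m1 B hB).2
  · intro x hx
    obtain ⟨C, hC, hxC⟩ := a3 x (by omega)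
    refine ⟨C.erase b, ?_, Finset.mem_erase.2 ⟨by omega, hxC⟩⟩
    simp only [ncSplit, Finset.mem_filter]
    refine ⟨Finset.mem_image_of_mem (fun B : Finset ℕ => B.erase b) hC, fun y hy => ?_⟩
    rw [Finset.mem_erase] at hy
    rw [Finset.mem_Ico]
    rcases hd C hC with h | ⟨h, h'⟩
    · have := h x hxC; omega
    · have := h y hy.2; omega
  · intro B hB C hC x hxB hxC
    obtain ⟨⟨B', hB', h1, h2⟩, -⟩ := m1 B hB
    obtain ⟨⟨C', hC', k1, k2⟩, -⟩ := m1 C hC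
    rw [← h2, ← k2, a4 B' hB' C' hC' x ((h1 x).1 hxB).1 ((k1 x).1 hxC).1]
  · intro B hB C hC x y z w hx hz hy hw
    obtain ⟨⟨B', hB', h1, h2⟩, -⟩ := m1 B hB
    obtain ⟨⟨C', hC', k1, k2⟩, -⟩ := m1 C hC
    intro l1 l2 l3
    rw [← h2, ← k2, a5 B' hB' C' hC' x y z w ((h1 x).1 hx).1 ((h1 z).1 hz).1 ((k1 y).1 hy).1
      ((k1 w).1 hw).1 l1 l2 l3]
  · exact fun B hB => a1 B (m2 B hB).1
  · exact fun B hB => (m2 B hB).2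
  · intro x hx
    obtain ⟨C, hC, hxC⟩ := a3 x (by omega)
    refine ⟨C, ?_, hxC⟩
    simp only [ncSplit, Finset.mem_filter]
    refine ⟨hC, fun y hy => ?_⟩
    rw [Finset.mem_Ico]
    rcases hd C hC with h | ⟨h, h'⟩
    · have := h y hy; omega
    · have := h x hxC; omega
  · exact fun B hB C hC => a4 B (m2 B hB).1 C (m2 C hC).1
  · exact fun B hB C hC => a5 B (m2 B hB).1 C (m2 C hC).1

theorem ncSplit_ncGlue {a p b : ℕ} (hpb : p < b)
    {ρ₁ ρ₂ : Finset (Finset ℕ)} (h₁ : ρ₁ ∈ ncOn (Finset.Ico a (p + 1)))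
    (h₂ : ρ₂ ∈ ncOn (Finset.Ico (p + 1) b)) :
    ncSplit a p b (ncGlue p b (ρ₁, ρ₂)) = (ρ₁, ρ₂) := by
  rw [mem_ncOn, isNCPartitionOn_iff] at h₁ h₂
  obtain ⟨a1, a2, a3, a4, a5⟩ := h₁
  obtain ⟨b1, b2, b3, b4, b5⟩ := h₂
  simp only [Finset.mem_Ico] at a2 a3 b2 b3
  have e1 : ∀ B ∈ ρ₁, (if p ∈ B then insert b B else B).erase b = B := by
    intro B hB
    have hb : b ∉ B := fun h => by have := a2 B hB b h; omega
    split_ifs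
    · exact Finset.erase_insert hb
    · exact Finset.erase_eq_of_notMem hb
  have e2 : ∀ B ∈ ρ₂, B.erase b = B := by
    intro B hB
    exact Finset.erase_eq_of_notMem fun h => by have := b2 B hB b h; omega
  refine Prod.ext ?_ ?_
  · ext B
    simp only [ncSplit, ncGlue, Finset.mem_filter, Finset.mem_image, Finset.mem_union]
    constructor
    · rintro ⟨⟨C, hC | ⟨B', hB', rfl⟩, rfl⟩, hs⟩
      · rw [e2 C hC] at hs
        obtain ⟨x, hx⟩ := b1 C hC
        have := b2 C hC x hx
        have := Finset.mem_Ico.1 (hs hx)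
        omega
      · rw [e1 B' hB']; exact hB'
    · intro hB
      exact ⟨⟨_, Or.inr ⟨B, hB, rfl⟩, e1 B hB⟩, fun x hx => Finset.mem_Ico.2 (a2 B hB x hx)⟩
  · ext B
    simp only [ncSplit, ncGlue, Finset.mem_filter, Finset.mem_image, Finset.mem_union]
    constructor
    · rintro ⟨hC | ⟨B', hB', rfl⟩, hs⟩
      · exact hC
      · obtain ⟨x, hx⟩ := a1 B' hB'
        have := a2 B' hB' x hx
        have := Finset.mem_Ico.1 (hs (by split_ifs <;> simp [hx] : x ∈ _))
        omega
    · intro hB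
      exact ⟨Or.inl hB, fun x hx => Finset.mem_Ico.2 (b2 B hB x hx)⟩

theorem ncGlue_ncSplit {a p b : ℕ} (hap : a ≤ p) (hpb : p < b)
    {ρ : Finset (Finset ℕ)} (h : ρ ∈ ncOn (Finset.Ico a (b + 1))) (hp : IsPrevOf p b ρ) :
    ncGlue p b (ncSplit a p b ρ) = ρ := by
  have hd := fun C hC => ncOn_dichotomy h hp (C := C) hC
  rw [mem_ncOn, isNCPartitionOn_iff] at h
  obtain ⟨a1, -⟩ := h
  have e1 : ∀ C : Finset ℕ, (b ∈ C ↔ p ∈ C) → (if p ∈ C.erase b then insert b (C.erase b) else C.erase b) = C := by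
    intro C hC
    by_cases hpC : p ∈ C
    · rw [if_pos (Finset.mem_erase.2 ⟨hpb.ne, hpC⟩), Finset.insert_erase (hC.2 hpC)]
    · rw [if_neg (fun h => hpC (Finset.mem_of_mem_erase h)),
        Finset.erase_eq_of_notMem (fun h => hpC (hC.1 h))]
  ext C
  simp only [ncSplit, ncGlue, Finset.mem_filter, Finset.mem_image, Finset.mem_union]
  constructor
  · rintro (⟨h, -⟩ | ⟨B, ⟨⟨C', hC', rfl⟩, hs⟩, rfl⟩)
    · exact h
    · rcases hd C' hC' with h | ⟨h, h'⟩
      · exfalso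
        obtain ⟨x, hx⟩ := a1 C' hC'
        have h1 := h x hx
        have := Finset.mem_Ico.1 (hs (Finset.mem_erase.2 ⟨h1.2.ne, hx⟩))
        omega
      · rw [e1 _ h']; exact hC'
  · intro hC
    rcases hd C hC with h | ⟨h, h'⟩
    · exact Or.inl ⟨hC, fun x hx => Finset.mem_Ico.2 (h x hx)⟩
    · refine Or.inr ⟨C.erase b, ⟨⟨C, hC, rfl⟩, fun x hx => ?_⟩, e1 C h'⟩
      rw [Finset.mem_erase] at hx
      rw [Finset.mem_Ico]
      have := h x hx.2
      omega

theorem blockWeight_ncGlue {R : Type*} [CommRing R] (c : ℕ → R) (s : ℕ) {a p b : ℕ} (hpb : p < b)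
    {ρ₁ ρ₂ : Finset (Finset ℕ)} (h₁ : ρ₁ ∈ ncOn (Finset.Ico a (p + 1)))
    (h₂ : ρ₂ ∈ ncOn (Finset.Ico (p + 1) b)) :
    blockWeight c s b (ncGlue p b (ρ₁, ρ₂)) =
      blockWeight c (s + 1) p ρ₁ * ∏ B ∈ ρ₂, c B.card := by
  rw [mem_ncOn, isNCPartitionOn_iff] at h₁ h₂
  obtain ⟨a1, a2, a3, a4, a5⟩ := h₁
  obtain ⟨b1, b2, b3, b4, b5⟩ := h₂
  simp only [Finset.mem_Ico] at a2 a3 b2 b3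
  have hb1 : ∀ B ∈ ρ₁, b ∉ B := fun B hB h => by have := a2 B hB b h; omega
  have hb2 : ∀ B ∈ ρ₂, b ∉ B := fun B hB h => by have := b2 B hB b h; omega
  unfold blockWeight ncGlue
  rw [Finset.prod_union, Finset.prod_image, mul_comm]
  · congr 1
    · refine Finset.prod_congr rfl fun B hB => ?_
      by_cases hpB : p ∈ B
      · simp only [hpB, if_true, Finset.mem_insert_self, Finset.card_insert_of_notMem (hb1 B hB)]
        congr 1; ring
      · simp [hpB, hb1 B hB]
    · exact Finset.prod_congr rfl fun B hB => by rw [if_neg (hb2 B hB)]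
  · intro B hB C hC hBC
    have := congrArg (fun B : Finset ℕ => B.erase b) hBC
    dsimp only at this
    have e : ∀ B ∈ ρ₁, (if p ∈ B then insert b B else B).erase b = B := by
      intro B hB
      split_ifs
      · exact Finset.erase_insert (hb1 B hB)
      · exact Finset.erase_eq_of_notMem (hb1 B hB)
    rwa [e B hB, e C hC] at this
  · rw [Finset.disjoint_left]
    intro B hB hB'
    obtain ⟨C, hC, rfl⟩ := Finset.mem_image.1 hB'
    obtain ⟨x, hx⟩ := a1 C hC
    have h1 := a2 C hC x hx
    have h2 := b2 _ hB x (by split_ifs <;> simp [hx])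
    omega

theorem sum_ncOn_isPrevOf {R : Type*} [CommRing R] (c : ℕ → R) (s : ℕ) {a p b : ℕ}
    (hap : a ≤ p) (hpb : p < b) :
    ∑ ρ ∈ (ncOn (Finset.Ico a (b + 1))).filter (IsPrevOf p b), blockWeight c s b ρ =
      (∑ ρ ∈ ncOn (Finset.Ico a (p + 1)), blockWeight c (s + 1) p ρ) *
        ∑ ρ ∈ ncOn (Finset.Ico (p + 1) b), ∏ B ∈ ρ, c B.card := by
  rw [Finset.sum_mul_sum, ← Finset.sum_product']
  symm
  refine Finset.sum_bij' (fun ρ _ => ncGlue p b ρ) (fun ρ _ => ncSplit a p b ρ) ?_ ?_ ?_ ?_ ?_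
  · rintro ⟨ρ₁, ρ₂⟩ h
    rw [Finset.mem_product] at h
    exact Finset.mem_filter.2 (ncGlue_mem hap hpb h.1 h.2)
  · intro ρ h
    rw [Finset.mem_filter] at h
    exact Finset.mem_product.2 (ncSplit_mem hap hpb h.1 h.2)
  · rintro ⟨ρ₁, ρ₂⟩ h
    rw [Finset.mem_product] at h
    exact ncSplit_ncGlue hpb h.1 h.2
  · intro ρ h
    rw [Finset.mem_filter] at h
    exact ncGlue_ncSplit hap hpb h.1 h.2
  · rintro ⟨ρ₁, ρ₂⟩ h
    rw [Finset.mem_product] at h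
    exact (blockWeight_ncGlue c s hpb h.1 h.2).symm

theorem sum_ncOn_singleton {R : Type*} [CommRing R] (c : ℕ → R) (s : ℕ) {a b : ℕ} (hab : a ≤ b) :
    ∑ ρ ∈ (ncOn (Finset.Ico a (b + 1))).filter (fun ρ => {b} ∈ ρ), blockWeight c s b ρ =
      c (s + 1) * ∑ ρ ∈ ncOn (Finset.Ico a b), ∏ B ∈ ρ, c B.card := by
  rw [Finset.mul_sum]
  symm
  have hnot : ∀ ρ ∈ ncOn (Finset.Ico a b), ∀ B ∈ ρ, b ∉ B := by
    intro ρ hρ B hB h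
    rw [mem_ncOn, isNCPartitionOn_iff] at hρ
    simpa using hρ.2.1 B hB b h
  refine Finset.sum_bij' (fun ρ _ => insert {b} ρ) (fun ρ _ => ρ.erase {b}) ?_ ?_ ?_ ?_ ?_
  · intro ρ h
    have hn := hnot ρ h
    refine Finset.mem_filter.2 ⟨?_, Finset.mem_insert_self _ _⟩
    rw [mem_ncOn, isNCPartitionOn_iff] at h ⊢
    obtain ⟨a1, a2, a3, a4, a5⟩ := h
    simp only [Finset.mem_Ico] at a2 a3
    simp only [Finset.mem_insert, Finset.mem_Ico]
    refine ⟨?_, ?_, ?_, ?_, ?_⟩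
    · rintro B (rfl | hB)
      · exact ⟨b, by simp⟩
      · exact a1 B hB
    · rintro B (rfl | hB) x hx
      · rw [Finset.mem_singleton] at hx; omega
      · have := a2 B hB x hx; omega
    · intro x hx
      by_cases hxb : x = b
      · exact ⟨{b}, Or.inl rfl, by simp [hxb]⟩
      · obtain ⟨B, hB, hx⟩ := a3 x (by omega)
        exact ⟨B, Or.inr hB, hx⟩
    · rintro B (rfl | hB) C (rfl | hC) x hxB hxC
      · rfl
      · rw [Finset.mem_singleton] at hxB; subst hxB; exact absurd hxC (hn C hC)
      · rw [Finset.mem_singleton] at hxC; subst hxC; exact absurd hxB (hn B hB)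
      · exact a4 B hB C hC x hxB hxC
    · rintro B (rfl | hB) C (rfl | hC) x y z w hx hz hy hw h1 h2 h3
      · rfl
      · rw [Finset.mem_singleton] at hx hz; omega
      · rw [Finset.mem_singleton] at hy hw; omega
      · exact a5 B hB C hC x y z w hx hz hy hw h1 h2 h3
  · intro ρ h
    obtain ⟨h, hb⟩ := Finset.mem_filter.1 h
    rw [mem_ncOn, isNCPartitionOn_iff] at h ⊢
    obtain ⟨a1, a2, a3, a4, a5⟩ := h
    simp only [Finset.mem_Ico] at a2 a3
    simp only [Finset.mem_erase, Finset.mem_Ico]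
    refine ⟨fun B hB => a1 B hB.2, fun B hB x hx => ?_, fun x hx => ?_,
      fun B hB C hC => a4 B hB.2 C hC.2, fun B hB C hC => a5 B hB.2 C hC.2⟩
    · have h1 := a2 B hB.2 x hx
      have : x ≠ b := by
        rintro rfl
        exact hB.1 (a4 B hB.2 _ hb x hx (by simp))
      omega
    · obtain ⟨B, hB, hxB⟩ := a3 x (by omega)
      refine ⟨B, ⟨?_, hB⟩, hxB⟩
      rintro rfl
      rw [Finset.mem_singleton] at hxB
      omega
  · intro ρ h
    exact Finset.erase_insert fun hb => hnot ρ h _ hb (by simp)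
  · intro ρ h
    exact Finset.insert_erase (Finset.mem_filter.1 h).2
  · intro ρ h
    have hn := hnot ρ h
    rw [blockWeight, Finset.prod_insert fun hb => hn _ hb (by simp)]
    simp only [Finset.mem_singleton, if_true, Finset.card_singleton]
    rw [add_comm]
    congr 1
    exact Finset.prod_congr rfl fun B hB => by rw [if_neg (hn B hB)]

theorem sum_ncOn_succ {R : Type*} [CommRing R] (c : ℕ → R) (s : ℕ) {a b : ℕ} (hab : a ≤ b) :
    ∑ ρ ∈ ncOn (Finset.Ico a (b + 1)), blockWeight c s b ρ =
      c (s + 1) * ∑ ρ ∈ ncOn (Finset.Ico a b), ∏ B ∈ ρ, c B.card +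
      ∑ p ∈ Finset.Ico a b, (∑ ρ ∈ ncOn (Finset.Ico a (p + 1)), blockWeight c (s + 1) p ρ) *
        ∑ ρ ∈ ncOn (Finset.Ico (p + 1) b), ∏ B ∈ ρ, c B.card := by
  rw [← sum_ncOn_singleton c s hab]
  rw [← Finset.sum_congr rfl fun p hp =>
    sum_ncOn_isPrevOf c s (Finset.mem_Ico.1 hp).1 (Finset.mem_Ico.1 hp).2]
  simp only [Finset.sum_filter]
  rw [Finset.sum_comm, ← Finset.sum_add_distrib]
  refine Finset.sum_congr rfl fun ρ hρ => ?_
  rw [mem_ncOn, isNCPartitionOn_iff] at hρ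
  obtain ⟨a1, a2, a3, a4, a5⟩ := hρ
  simp only [Finset.mem_Ico] at a2 a3
  obtain ⟨B, hB, hbB⟩ := a3 b (by omega)
  by_cases hs : {b} ∈ ρ
  · rw [if_pos hs, Finset.sum_eq_zero, add_zero]
    intro p hp
    rw [Finset.mem_Ico] at hp
    refine if_neg ?_
    rintro ⟨C, hC, hbC, hpC, -⟩
    have := a4 C hC _ hs b hbC (by simp)
    subst this
    rw [Finset.mem_singleton] at hpC
    omega
  · rw [if_neg hs, zero_add]
    have hne : (B.erase b).Nonempty := by
      rw [Finset.nonempty_iff_ne_empty]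
      intro h
      rcases (Finset.erase_eq_empty_iff _ _).1 h with h | h
      · subst h; simp at hbB
      · exact hs (h ▸ hB)
    have hm := Finset.max'_mem _ hne
    set p := (B.erase b).max' hne with hp
    rw [Finset.mem_erase] at hm
    have hpB := a2 B hB p hm.2
    rw [Finset.sum_eq_single_of_mem p (Finset.mem_Ico.2 (by omega)), if_pos]
    · refine ⟨B, hB, hbB, hm.2, fun x hx => ?_⟩
      by_cases hxb : x = b
      · exact Or.inr hxb
      · exact Or.inl (Finset.le_max' _ _ (Finset.mem_erase.2 ⟨hxb, hx⟩))
    · intro q hq hqp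
      refine if_neg ?_
      rintro ⟨C, hC, hbC, hqC, hmax⟩
      have := a4 C hC B hB b hbC hbB
      subst this
      rw [Finset.mem_Ico] at hq
      have h1 := hmax p hm.2
      have h2 : q ≤ p := Finset.le_max' _ _ (Finset.mem_erase.2 ⟨by omega, hqC⟩)
      omega

/-- The generating sum over non-crossing partitions of `{a, …, a + n - 1}`, where `s` is added to
the size of the block of the largest element. -/
noncomputable def ncSum {R : Type*} [CommRing R] (c : ℕ → R) (a s : ℕ) : ℕ → R
  | 0 => c s
  | n + 1 => ∑ ρ ∈ ncOn (Finset.Ico a (a + n + 1)), blockWeight c s (a + n) ρ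

theorem ncOn_empty : ncOn ∅ = {∅} := by
  ext ρ
  rw [mem_ncOn, isNCPartitionOn_iff, Finset.mem_singleton]
  constructor
  · rintro ⟨h1, h2, -⟩
    refine Finset.eq_empty_of_forall_notMem fun B hB => ?_
    obtain ⟨x, hx⟩ := h1 B hB
    simpa using h2 B hB x hx
  · rintro rfl
    simp

theorem ncSum_zero_eq {R : Type*} [CommRing R] (c : ℕ → R) (h0 : c 0 = 1) (a n : ℕ) :
    ncSum c a 0 n = ∑ ρ ∈ ncOn (Finset.Ico a (a + n)), ∏ B ∈ ρ, c B.card := by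
  cases n with
  | zero => simp [ncSum, ncOn_empty, h0]
  | succ n => simp [ncSum, blockWeight, add_assoc]

theorem ncSum_succ_aux {R : Type*} [CommRing R] (c : ℕ → R) (h0 : c 0 = 1) (a s n : ℕ) :
    ncSum c a s (n + 1) =
      ∑ i ∈ Finset.range (n + 1), ncSum c a (s + 1) i * ncSum c (a + i) 0 (n - i) := by
  rw [ncSum, sum_ncOn_succ c s (Nat.le_add_right a n), Finset.sum_range_succ', add_comm]
  congr 1
  · rw [Finset.sum_Ico_eq_sum_range, Nat.add_sub_cancel_left]
    refine Finset.sum_congr rfl fun i hi => ?_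
    rw [Finset.mem_range] at hi
    rw [ncSum_zero_eq c h0, ncSum]
    have : a + (i + 1) + (n - (i + 1)) = a + n := by omega
    rw [this]
    rfl
  · rw [ncSum_zero_eq c h0]
    simp [ncSum]

theorem ncSum_shift {R : Type*} [CommRing R] (c : ℕ → R) (h0 : c 0 = 1) (n : ℕ) :
    ∀ a b s : ℕ, ncSum c a s n = ncSum c b s n := by
  induction n using Nat.strong_induction_on with
  | _ n ih =>
    intro a b s
    cases n with
    | zero => rfl
    | succ n =>
      rw [ncSum_succ_aux c h0, ncSum_succ_aux c h0]
      refine Finset.sum_congr rfl fun i hi => ?_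
      rw [Finset.mem_range] at hi
      rw [ih i (by omega) a b, ih (n - i) (by omega) (a + i) (b + i)]

theorem ncSum_succ {R : Type*} [CommRing R] (c : ℕ → R) (h0 : c 0 = 1) (a s n : ℕ) :
    ncSum c a s (n + 1) =
      ∑ p ∈ Finset.HasAntidiagonal.antidiagonal n, ncSum c a (s + 1) p.1 * ncSum c a 0 p.2 := by
  rw [ncSum_succ_aux c h0, Finset.Nat.sum_antidiagonal_eq_sum_range_succ_mk]
  exact Finset.sum_congr rfl fun i _ => by rw [ncSum_shift c h0 (n - i) (a + i) a]

theorem ncSum_eq_zero {R : Type*} [CommRing R] (c : ℕ → R) (h0 : c 0 = 1) (a K : ℕ)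
    (hc : ∀ s, K < s → c s = 0) (n : ℕ) : ∀ s, K < s → ncSum c a s n = 0 := by
  induction n using Nat.strong_induction_on with
  | _ n ih =>
    intro s hs
    cases n with
    | zero => exact hc s hs
    | succ n =>
      rw [ncSum_succ c h0]
      refine Finset.sum_eq_zero fun p hp => ?_
      rw [Finset.HasAntidiagonal.mem_antidiagonal] at hp
      rw [ih p.1 (by omega) (s + 1) (by omega), zero_mul]

theorem ncFinset_eq (k : ℕ) : NCFinset k = ncOn (Finset.Ico 1 (1 + k)) := by
  rw [NCFinset, ncOn]
  have : Finset.Icc 1 k = Finset.Ico 1 (1 + k) := by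
    ext x; simp only [Finset.mem_Icc, Finset.mem_Ico]; omega
  rw [this]

open PowerSeries in
theorem powerSeries_markov_krein (K : ℕ) (A L : ℕ → ℝ⟦X⟧) (c : ℕ → ℝ) (h0 : c 0 = 1)
    (hA : ∀ s, A s = C (c s) + X * (A (s + 1) * A 0))
    (hL : ∀ s, L s = C (if s = 0 then 0 else c s) + X * (L (s + 1) * A 0 + A (s + 1) * L 0))
    (hAK : A K = 0) (hLK : L K = 0) (hK : 0 < K) :
    (d⁄dX ℝ (X * A 0) - L 0) * A 0 = d⁄dX ℝ (X * A 0) := by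
  set W := A 0 with hW
  set D := d⁄dX ℝ (X * W) with hD
  set Q := ∑ s ∈ Finset.range K, (X * W) ^ s * A (s + 1) with hQ
  have e1 : ∀ m, W = ∑ s ∈ Finset.range m, (X * W) ^ s * C (c s) + (X * W) ^ m * A m := by
    intro m
    induction m with
    | zero => simp [hW]
    | succ m ih =>
      rw [Finset.sum_range_succ]
      nth_rewrite 1 [ih]
      rw [hA m]
      ring
  have e2 : ∀ m, d⁄dX ℝ W = D * ∑ s ∈ Finset.range m, (X * W) ^ s * A (s + 1) +
      (X * W) ^ m * d⁄dX ℝ (A m) := by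
    intro m
    induction m with
    | zero => simp [hW]
    | succ m ih =>
      have : d⁄dX ℝ (A m) = D * A (m + 1) + X * W * d⁄dX ℝ (A (m + 1)) := by
        have h : A m = C (c m) + (X * W) * A (m + 1) := by rw [hA m]; ring
        rw [h, map_add, Derivation.leibniz, smul_eq_mul, smul_eq_mul, ← hD]
        simp
        ring
      rw [Finset.sum_range_succ]
      nth_rewrite 1 [ih]
      rw [this]
      ring
  have e3 : ∀ m, L 0 = ∑ s ∈ Finset.range m, (X * W) ^ s * C (if s = 0 then 0 else c s) +
      X * L 0 * ∑ s ∈ Finset.range m, (X * W) ^ s * A (s + 1) + (X * W) ^ m * L m := by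
    intro m
    induction m with
    | zero => simp
    | succ m ih =>
      rw [Finset.sum_range_succ, Finset.sum_range_succ]
      nth_rewrite 1 [ih]
      rw [hL m]
      ring
  have f1 := e1 K
  have f2 := e2 K
  have f3 := e3 K
  rw [hAK, mul_zero, add_zero] at f1
  rw [hAK, map_zero, mul_zero, add_zero, ← hQ] at f2
  rw [hLK, mul_zero, add_zero, ← hQ] at f3
  obtain ⟨K, rfl⟩ : ∃ k, K = k + 1 := ⟨K - 1, by omega⟩
  rw [Finset.sum_range_succ'] at f1 f3
  simp only [h0, pow_zero, if_true, map_one, map_zero, mul_zero, add_zero, mul_one,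
    Nat.succ_ne_zero, if_false] at f1 f3
  have hDW : D = W + X * d⁄dX ℝ W := by
    rw [hD, Derivation.leibniz]
    simp
    ring
  have hne : (1 - X * Q : ℝ⟦X⟧) ≠ 0 := by
    intro h
    have := congrArg (constantCoeff (R := ℝ)) h
    simp at this
  refine mul_right_cancel₀ hne ?_
  have g3 : L 0 * (1 - X * Q) = W - 1 := by linear_combination f3 - f1
  have g2 : D * (1 - X * Q) = W := by linear_combination hDW + X * f2
  linear_combination (W - 1) * g2 - W * g3

theorem derivative_prod_X_mul_C (c : ℕ → ℝ) (ρ : Finset (Finset ℕ)) :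
    ((∏ B ∈ ρ, (Polynomial.X * Polynomial.C (c B.card))).derivative).eval 1 =
      ρ.card * ∏ B ∈ ρ, c B.card := by
  have h : ∏ B ∈ ρ, Polynomial.C (c B.card) = Polynomial.C (∏ B ∈ ρ, c B.card) :=
    (map_prod _ _ _).symm
  rw [Finset.prod_mul_distrib, Finset.prod_const, h, Polynomial.derivative_mul,
    Polynomial.derivative_X_pow]
  generalize ∏ B ∈ ρ, c B.card = r
  simp

/-- The transform `∑_ρ (k + 1 - |ρ|) fc_ρ` satisfies Newton's identities with respect to the
moments. -/
theorem isNewtonPair_freeCumulant (x y c : ℕ → ℝ) (hx0 : x 0 = 1)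
    (hx : ∀ k, 1 ≤ k → x k = ∑ ρ ∈ NCFinset k, ∏ B ∈ ρ, c B.card)
    (hy : ∀ k, y k = ∑ ρ ∈ NCFinset k, ((k : ℝ) + 1 - ρ.card) * ∏ B ∈ ρ, c B.card) :
    IsNewtonPair x y := by
  refine ⟨hx0, fun k => ?_⟩
  set K := k + 1 with hK
  set c' : ℕ → Polynomial ℝ := fun s => if s = 0 then 1 else
    if s ≤ K then Polynomial.X * Polynomial.C (c s) else 0 with hc'
  have h0 : c' 0 = 1 := by simp [c']
  have hcK : ∀ s, K < s → c' s = 0 := by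
    intro s hs
    simp only [c', if_neg (not_le.2 hs), if_neg (by omega : ¬ s = 0)]
  set f := ncSum c' 1 with hf
  have hf0 : ∀ j ≤ K, f 0 j =
      ∑ ρ ∈ NCFinset j, ∏ B ∈ ρ, (Polynomial.X * Polynomial.C (c B.card)) := by
    intro j hj
    rw [hf, ncSum_zero_eq c' h0, ncFinset_eq]
    refine Finset.sum_congr rfl fun ρ hρ => Finset.prod_congr rfl fun B hB => ?_
    rw [mem_ncOn, isNCPartitionOn_iff] at hρ
    obtain ⟨x, hx⟩ := hρ.1 B hB
    have h1 : B.card ≠ 0 := Finset.card_ne_zero_of_mem hx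
    have h2 : B.card ≤ K := by
      have := Finset.card_le_card (hρ.2.1 B hB : B ⊆ _)
      rw [Nat.card_Ico] at this
      omega
    simp [c', h1, h2]
  set A : ℕ → PowerSeries ℝ := fun s => PowerSeries.mk fun n => (f s n).eval 1 with hA
  set L : ℕ → PowerSeries ℝ := fun s => PowerSeries.mk fun n => (f s n).derivative.eval 1 with hL
  have key := powerSeries_markov_krein (K + 1) A L (fun s => (c' s).eval 1) (by simp [h0])
    (by
      intro s
      ext n
      cases n with
      | zero => simp [A, f, ncSum]
      | succ n =>
        rw [map_add, PowerSeries.coeff_succ_X_mul, PowerSeries.coeff_mul]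
        simp [A, f, ncSum_succ c' h0, Polynomial.eval_finsetSum])
    (by
      intro s
      ext n
      cases n with
      | zero =>
        simp [L, f, ncSum, c']
        split_ifs <;> simp
      | succ n =>
        rw [map_add, PowerSeries.coeff_succ_X_mul, map_add, PowerSeries.coeff_mul,
          PowerSeries.coeff_mul, ← Finset.sum_add_distrib]
        simp [A, L, f, ncSum_succ c' h0, Polynomial.eval_finsetSum])
    (by ext n; simp [A, f, ncSum_eq_zero c' h0 1 K hcK n (K + 1) (by omega)])
    (by ext n; simp [L, f, ncSum_eq_zero c' h0 1 K hcK n (K + 1) (by omega)])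
    (by omega)
  have hA0 : ∀ j ≤ K, PowerSeries.coeff j (A 0) = x j := by
    intro j hj
    simp only [A, PowerSeries.coeff_mk]
    rcases Nat.eq_zero_or_pos j with rfl | hj0
    · simp [f, ncSum, h0, hx0]
    · rw [hf0 j hj, hx j hj0, Polynomial.eval_finsetSum]
      refine Finset.sum_congr rfl fun ρ _ => ?_
      simp [Polynomial.eval_prod]
  have hL0 : ∀ j ≤ K, PowerSeries.coeff j (L 0) =
      ∑ ρ ∈ NCFinset j, ρ.card * ∏ B ∈ ρ, c B.card := by
    intro j hj
    simp only [L, PowerSeries.coeff_mk]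
    rw [hf0 j hj, Polynomial.derivative_sum, Polynomial.eval_finsetSum]
    exact Finset.sum_congr rfl fun ρ _ => derivative_prod_X_mul_C c ρ
  have hder : ∀ j ≤ K, PowerSeries.coeff j (PowerSeries.derivative ℝ (PowerSeries.X * A 0)) =
      (j + 1) * x j := by
    intro j hj
    rw [PowerSeries.coeff_derivative, PowerSeries.coeff_succ_X_mul, hA0 j hj, mul_comm]
  have hT : ∀ j ≤ K, 1 ≤ j → PowerSeries.coeff j
      (PowerSeries.derivative ℝ (PowerSeries.X * A 0) - L 0) = y j := by
    intro j hj hj1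
    rw [map_sub, hder j hj, hL0 j hj, hy, hx j hj1, Finset.mul_sum, ← Finset.sum_sub_distrib]
    exact Finset.sum_congr rfl fun ρ _ => by ring
  have hT0 : PowerSeries.coeff 0
      (PowerSeries.derivative ℝ (PowerSeries.X * A 0) - L 0) = 1 := by
    rw [map_sub, hder 0 (by omega), hL0 0 (by omega), ncFinset_eq]
    simp [ncOn_empty, hx0]
  have hk := congrArg (PowerSeries.coeff (k + 1)) key
  rw [hder _ le_rfl, mul_comm, PowerSeries.coeff_mul, Finset.Nat.sum_antidiagonal_succ', hT0,
    hA0 _ le_rfl, mul_one] at hk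
  have : ∑ p ∈ Finset.HasAntidiagonal.antidiagonal k, x p.1 * y (p.2 + 1) =
      ∑ p ∈ Finset.HasAntidiagonal.antidiagonal k, PowerSeries.coeff p.1 (A 0) *
        PowerSeries.coeff (p.2 + 1) (PowerSeries.derivative ℝ (PowerSeries.X * A 0) - L 0) := by
    refine Finset.sum_congr rfl fun p hp => ?_
    rw [Finset.HasAntidiagonal.mem_antidiagonal] at hp
    rw [hA0 _ (by omega), hT _ (by omega) (by omega)]
  rw [this]
  have hKr : (K : ℝ) = k + 1 := by rw [hK]; push_cast; ring
  linear_combination hk + x K * hKr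

/-- The space of polynomials in the variables `x 0, x 1, …` that are homogeneous of degree `d`
when `x j` is given weight `j`, viewed as functions. -/
def weightedPolys (d : ℕ) : Submodule ℝ ((ℕ → ℝ) → ℝ) :=
  Submodule.span ℝ {f | ∃ (ι : Type) (_ : Fintype ι) (j : ι → ℕ),
    ∑ r, j r = d ∧ f = fun x => ∏ r, x (j r)}

theorem mul_mem_weightedPolys {d e : ℕ} {f g : (ℕ → ℝ) → ℝ} (hf : f ∈ weightedPolys d)
    (hg : g ∈ weightedPolys e) : f * g ∈ weightedPolys (d + e) := by
  have h := Submodule.mul_mem_mul hf hg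
  rw [weightedPolys, weightedPolys, Submodule.span_mul_span] at h
  refine Submodule.span_mono ?_ h
  rintro _ ⟨_, ⟨ι, _, j, hj, rfl⟩, _, ⟨κ, _, l, hl, rfl⟩, rfl⟩
  refine ⟨ι ⊕ κ, inferInstance, Sum.elim j l, ?_, ?_⟩
  · simp [hj, hl]
  · funext x
    simp [Fintype.prod_sum_type]

theorem apply_mem_weightedPolys (d : ℕ) : (fun x : ℕ → ℝ => x d) ∈ weightedPolys d :=
  Submodule.subset_span ⟨Unit, inferInstance, fun _ => d, by simp, by simp⟩

theorem exists_weightedPolys_of_isNewtonPair (k : ℕ) :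
    ∃ f ∈ weightedPolys (k + 1), ∀ x y, IsNewtonPair x y → y (k + 1) = f x := by
  induction k using Nat.strong_induction_on with
  | _ k ih =>
    choose! g hg hgy using ih
    refine ⟨((k : ℝ) + 1) • (fun x : ℕ → ℝ => x (k + 1)) -
      ∑ i ∈ (Finset.range k).attach, (fun x : ℕ → ℝ => x (i + 1)) * g (k - (i + 1)), ?_, ?_⟩
    · refine Submodule.sub_mem _ (Submodule.smul_mem _ _ (apply_mem_weightedPolys _))
        (Submodule.sum_mem _ fun i _ => ?_)
      have hi := Finset.mem_range.1 i.2
      have := mul_mem_weightedPolys (apply_mem_weightedPolys (i.1 + 1))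
        (hg (k - (i.1 + 1)) (by omega))
      rwa [show i.1 + 1 + (k - (i.1 + 1) + 1) = k + 1 by omega] at this
    · intro x y hxy
      have h := hxy.2 k
      rw [Finset.Nat.sum_antidiagonal_eq_sum_range_succ_mk, Finset.sum_range_succ'] at h
      have h2 : ∑ i ∈ Finset.range k, x (i + 1) * y (k - (i + 1) + 1) =
          ∑ i ∈ (Finset.range k).attach, x (i + 1) * g (k - (i + 1)) x := by
        rw [← Finset.sum_attach]
        refine Finset.sum_congr rfl fun i _ => ?_
        rw [hgy _ (by have := Finset.mem_range.1 i.2; omega) x y hxy]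
      simp only [h2, hxy.1, one_mul, Nat.sub_zero] at h
      simp only [Pi.sub_apply, Pi.smul_apply, smul_eq_mul, Finset.sum_apply, Pi.mul_apply]
      linarith

instance matrixBorelSpace {m n : Type*} [Finite m] [Finite n] : BorelSpace (Matrix m n ℂ) :=
  inferInstanceAs (BorelSpace (m → n → ℂ))

instance matrixSecondCountableTopology {m n : Type*} [Finite m] [Finite n] :
    SecondCountableTopology (Matrix m n ℂ) :=
  inferInstanceAs (SecondCountableTopology (m → n → ℂ))

instance unitaryGroupCompactSpace {n : Type*} [Fintype n] [DecidableEq n] :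
    CompactSpace (Matrix.unitaryGroup n ℂ) := by
  suffices IsCompact (Matrix.unitaryGroup n ℂ : Set (Matrix n n ℂ)) from
    isCompact_iff_compactSpace.1 this
  have hclosed : IsClosed (Matrix.unitaryGroup n ℂ : Set (Matrix n n ℂ)) := by
    have : (Matrix.unitaryGroup n ℂ : Set (Matrix n n ℂ)) = {A | star A * A = 1} ∩ {A | A * star A = 1} := by
      ext A; simp [Matrix.unitaryGroup, Unitary.mem_iff]
    rw [this]
    exact (isClosed_eq (by fun_prop) continuous_const).inter
      (isClosed_eq (by fun_prop) continuous_const)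
  have hcompact : IsCompact (Set.univ.pi fun _ : n => Set.univ.pi fun _ : n =>
      Metric.closedBall (0 : ℂ) 1) :=
    isCompact_univ_pi fun _ => isCompact_univ_pi fun _ => isCompact_closedBall 0 1
  refine IsCompact.of_isClosed_subset hcompact hclosed fun A hA => ?_
  exact fun i _ j _ => mem_closedBall_zero_iff.2 (entry_norm_bound_of_unitary hA i j)

theorem measurePreserving_mul_right_of_isHaarMeasure {G : Type*} [Group G] [TopologicalSpace G]
    [IsTopologicalGroup G] [CompactSpace G] [SecondCountableTopology G] [MeasurableSpace G]
    [BorelSpace G] (μ : Measure G) [μ.IsHaarMeasure] [IsProbabilityMeasure μ] (g : G) :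
    MeasurePreserving (· * g) μ μ := by
  refine ⟨measurable_mul_const g, ?_⟩
  have : IsProbabilityMeasure (μ.map (· * g)) :=
    Measure.isProbabilityMeasure_map (measurable_mul_const g).aemeasurable
  exact Measure.isHaarMeasure_eq_of_isProbabilityMeasure _ _

/-- If `U` is Haar distributed, then so is `U V` for each fixed unitary `V`. -/
theorem integral_comp_mul_of_isHaarMeasure {Ω : Type*} [MeasurableSpace Ω] {P : Measure Ω}
    [IsProbabilityMeasure P] {n : ℕ} {U : Ω → Matrix (Fin n) (Fin n) ℂ} (hU : Measurable U)
    (huni : ∀ ω, U ω ∈ Matrix.unitaryGroup (Fin n) ℂ)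
    (hHaar : (P.map fun ω => (⟨U ω, huni ω⟩ : Matrix.unitaryGroup (Fin n) ℂ)).IsHaarMeasure)
    {V : Matrix (Fin n) (Fin n) ℂ} (hV : V ∈ Matrix.unitaryGroup (Fin n) ℂ)
    {f : Matrix (Fin n) (Fin n) ℂ → ℝ} (hf : Measurable f) :
    ∫ ω, f (U ω * V) ∂P = ∫ ω, f (U ω) ∂P := by
  set S : Ω → Matrix.unitaryGroup (Fin n) ℂ := fun ω => ⟨U ω, huni ω⟩ with hS
  have hSm : Measurable S := hU.subtype_mk
  have : SecondCountableTopology (Matrix.unitaryGroup (Fin n) ℂ) :=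
    TopologicalSpace.Subtype.secondCountableTopology
      (Matrix.unitaryGroup (Fin n) ℂ : Set (Matrix (Fin n) (Fin n) ℂ))
  have : IsProbabilityMeasure (P.map S) := Measure.isProbabilityMeasure_map hSm.aemeasurable
  have hmp := measurePreserving_mul_right_of_isHaarMeasure (P.map S) ⟨V, hV⟩
  have hfm : Measurable fun A : Matrix.unitaryGroup (Fin n) ℂ => f A :=
    hf.comp measurable_subtype_coe
  calc ∫ ω, f (U ω * V) ∂P
      = ∫ A, f ((A * ⟨V, hV⟩ : Matrix.unitaryGroup (Fin n) ℂ) : Matrix (Fin n) (Fin n) ℂ) ∂(P.map S) :=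
        (integral_map hSm.aemeasurable
          (hfm.comp (measurable_mul_const ⟨V, hV⟩)).aestronglyMeasurable).symm
    _ = ∫ A, f A ∂(P.map S) := by
        conv_rhs => rw [← hmp.map_eq]
        exact (integral_map (measurable_mul_const _).aemeasurable hfm.aestronglyMeasurable).symm
    _ = ∫ ω, f (U ω) ∂P := integral_map hSm.aemeasurable hfm.aestronglyMeasurable

theorem add_pow_le_add_mixed (l : ℕ) : ∃ K : ℝ, 0 ≤ K ∧ ∀ a b : ℝ, 0 ≤ a → 0 ≤ b →
    (a + b) ^ (l + 2) ≤ a ^ (l + 2) + b ^ (l + 2) + K * (a ^ (l + 1) * b + a * b ^ (l + 1)) := by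
  induction l with
  | zero => exact ⟨1, by norm_num, fun a b _ _ => by ring_nf; rfl⟩
  | succ l ih =>
    obtain ⟨K, hK, h⟩ := ih
    refine ⟨1 + 2 * K, by positivity, fun a b ha hb => ?_⟩
    have h1 := mul_le_mul_of_nonneg_left (h a b ha hb) (add_nonneg ha hb)
    have h2 : 0 ≤ a * b * ((a - b) * (a ^ l - b ^ l)) := by
      refine mul_nonneg (mul_nonneg ha hb) ?_
      rcases le_total a b with hab | hab
      · exact mul_nonneg_of_nonpos_of_nonpos (sub_nonpos.2 hab)
          (sub_nonpos.2 (pow_le_pow_left₀ ha hab _))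
      · exact mul_nonneg (sub_nonneg.2 hab) (sub_nonneg.2 (pow_le_pow_left₀ hb hab _))
    have h3 := mul_nonneg hK h2
    refine le_trans (le_of_eq (by ring)) (h1.trans ?_)
    refine le_of_sub_nonneg (h3.trans_eq ?_)
    ring

theorem add_pow_add_sub_pow_le (l : ℕ) : ∃ K : ℝ, 0 ≤ K ∧ ∀ A B : ℝ, |B| ≤ A →
    (A + B) ^ (l + 2) + (A - B) ^ (l + 2) ≤ 2 * A ^ (l + 2) + K * (B ^ 2 * A ^ l) ∧
    B * ((A + B) ^ (l + 1) - (A - B) ^ (l + 1)) ≤ K * (B ^ 2 * A ^ l) := by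
  induction l with
  | zero => exact ⟨2, by norm_num, fun A B _ => ⟨by ring_nf; rfl, by ring_nf; rfl⟩⟩
  | succ l ih =>
    obtain ⟨K, hK, h⟩ := ih
    refine ⟨2 * K + 2 * 2 ^ (l + 1), by positivity, fun A B hAB => ?_⟩
    obtain ⟨h1, h2⟩ := h A B hAB
    have hA : 0 ≤ A := (abs_nonneg B).trans hAB
    obtain ⟨hB1, hB2⟩ := abs_le.1 hAB
    have h3 : (A + B) ^ (l + 1) + (A - B) ^ (l + 1) ≤ 2 * 2 ^ (l + 1) * A ^ (l + 1) := by
      have e1 : (A + B) ^ (l + 1) ≤ (2 * A) ^ (l + 1) :=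
        pow_le_pow_left₀ (by linarith) (by linarith) _
      have e2 : (A - B) ^ (l + 1) ≤ (2 * A) ^ (l + 1) :=
        pow_le_pow_left₀ (by linarith) (by linarith) _
      rw [mul_pow] at e1 e2
      linarith
    have h4 : B * ((A + B) ^ (l + 2) - (A - B) ^ (l + 2)) ≤
        (K + 2 * 2 ^ (l + 1)) * (B ^ 2 * A ^ (l + 1)) := by
      have e1 := mul_le_mul_of_nonneg_left h2 hA
      have e2 := mul_le_mul_of_nonneg_left h3 (sq_nonneg B)
      refine le_trans (le_of_eq ?_) ((add_le_add e1 e2).trans (le_of_eq ?_)) <;> ring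
    have h0 : 0 ≤ B ^ 2 * A ^ (l + 1) := by positivity
    constructor
    · have e1 := mul_le_mul_of_nonneg_left h1 hA
      refine le_trans (le_of_eq ?_) ((add_le_add e1 h4).trans (le_of_eq ?_)) <;> ring
    · refine h4.trans ?_
      nlinarith

theorem normSq_rotation_pow_le (l : ℕ) : ∃ K : ℝ, 0 ≤ K ∧ ∀ z w : ℂ,
    Complex.normSq (-(3 / 5) * z + 4 / 5 * w) ^ (l + 2) +
      Complex.normSq (-(3 / 5) * z - 4 / 5 * w) ^ (l + 2) ≤
    2 * ((9 / 25) ^ (l + 2) * Complex.normSq z ^ (l + 2) +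
      (16 / 25) ^ (l + 2) * Complex.normSq w ^ (l + 2)) +
    K * (Complex.normSq z ^ (l + 1) * Complex.normSq w +
      Complex.normSq z * Complex.normSq w ^ (l + 1)) := by
  obtain ⟨K, hK, h⟩ := add_pow_le_add_mixed l
  obtain ⟨L, hL, h'⟩ := add_pow_add_sub_pow_le l
  refine ⟨2 * K + L * 2 ^ l, by positivity, fun z w => ?_⟩
  set s := Complex.normSq z with hs
  set t := Complex.normSq w with ht
  have hs0 : 0 ≤ s := Complex.normSq_nonneg _
  have ht0 : 0 ≤ t := Complex.normSq_nonneg _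
  set A : ℝ := 9 / 25 * s + 16 / 25 * t with hA
  set B : ℝ := -(24 / 25) * (z.re * w.re + z.im * w.im) with hB
  have hp : Complex.normSq (-(3 / 5) * z + 4 / 5 * w) = A + B := by
    simp [Complex.normSq_apply, hA, hB, hs, ht]; norm_num; ring
  have hq : Complex.normSq (-(3 / 5) * z - 4 / 5 * w) = A - B := by
    simp [Complex.normSq_apply, hA, hB, hs, ht]; norm_num; ring
  have hp0 := Complex.normSq_nonneg (-(3 / 5) * z + 4 / 5 * w)
  have hq0 := Complex.normSq_nonneg (-(3 / 5) * z - 4 / 5 * w)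
  rw [hp] at hp0 ⊢
  rw [hq] at hq0 ⊢
  have hAB : |B| ≤ A := abs_le.2 ⟨by linarith, by linarith⟩
  have hB2 : B ^ 2 ≤ s * t := by
    have : s * t = (z.re * w.re + z.im * w.im) ^ 2 + (z.re * w.im - z.im * w.re) ^ 2 := by
      simp [hs, ht, Complex.normSq_apply]; ring
    rw [this, hB]
    nlinarith [sq_nonneg (z.re * w.re + z.im * w.im), sq_nonneg (z.re * w.im - z.im * w.re)]
  have hAst : A ^ l ≤ 2 ^ l * (s ^ l + t ^ l) := by
    refine (pow_le_pow_left₀ (by positivity) (by linarith : A ≤ s + t) l).trans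
      ((add_pow_le hs0 ht0 l).trans ?_)
    gcongr
    · norm_num
    · omega
  have e1 := h (9 / 25 * s) (16 / 25 * t) (by positivity) (by positivity)
  have e2 : (9 / 25 * s) ^ (l + 1) * (16 / 25 * t) + 9 / 25 * s * (16 / 25 * t) ^ (l + 1) ≤
      s ^ (l + 1) * t + s * t ^ (l + 1) := by
    gcongr <;> linarith
  have e3 : B ^ 2 * A ^ l ≤ s * t * (2 ^ l * (s ^ l + t ^ l)) := by
    gcongr
  have e4 := (h' A B hAB).1
  have e5 := mul_le_mul_of_nonneg_left e2 hK
  have e6 := mul_le_mul_of_nonneg_left e3 hL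
  calc _ ≤ _ := e4
    _ ≤ 2 * ((9 / 25 * s) ^ (l + 2) + (16 / 25 * t) ^ (l + 2) +
          K * (s ^ (l + 1) * t + s * t ^ (l + 1))) +
        L * (s * t * (2 ^ l * (s ^ l + t ^ l))) := by linarith
    _ = _ := by ring

/-- `z` is distributed like a row of a Haar distributed unitary matrix: a random unit vector whose
law is invariant under unitary transformations. -/
structure IsHaarRow {Ω : Type*} [MeasurableSpace Ω] (P : Measure Ω) {n : ℕ}
    (z : Ω → Fin n → ℂ) : Prop where
  measurable : Measurable z
  sum_normSq : ∀ ω, ∑ i, Complex.normSq (z ω i) = 1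
  integral_vecMul : ∀ V ∈ Matrix.unitaryGroup (Fin n) ℂ, ∀ f : (Fin n → ℂ) → ℝ, Measurable f →
    ∫ ω, f (Matrix.vecMul (z ω) V) ∂P = ∫ ω, f (z ω) ∂P

theorem sum_normSq_row_of_unitary {n : ℕ} {U : Matrix (Fin n) (Fin n) ℂ}
    (hU : U ∈ Matrix.unitaryGroup (Fin n) ℂ) (a : Fin n) : ∑ i, Complex.normSq (U a i) = 1 := by
  have h := congrFun (congrFun (Matrix.mem_unitaryGroup_iff.1 hU) a) a
  rw [Matrix.mul_apply] at h
  simp only [Matrix.star_apply, Matrix.one_apply_eq, RCLike.star_def, Complex.mul_conj] at h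
  exact_mod_cast h

theorem isHaarRow_of_isHaarMeasure {Ω : Type*} [MeasurableSpace Ω] {P : Measure Ω}
    [IsProbabilityMeasure P] {n : ℕ} {U : Ω → Matrix (Fin n) (Fin n) ℂ} (hU : Measurable U)
    (huni : ∀ ω, U ω ∈ Matrix.unitaryGroup (Fin n) ℂ)
    (hHaar : (P.map fun ω => (⟨U ω, huni ω⟩ : Matrix.unitaryGroup (Fin n) ℂ)).IsHaarMeasure)
    (a : Fin n) : IsHaarRow P fun ω => U ω a where
  measurable := (measurable_pi_apply a).comp hU
  sum_normSq ω := sum_normSq_row_of_unitary (huni ω) a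
  integral_vecMul V hV f hf := by
    have := integral_comp_mul_of_isHaarMeasure hU huni hHaar hV
      (f := fun A => f (A a)) (hf.comp (measurable_pi_apply a))
    simpa only [Matrix.mul_apply_eq_vecMul] using this

theorem one_sub_vecMulVec_mem_unitaryGroup {n : ℕ} (y : Fin n → ℝ) (hy : ∑ i, y i ^ 2 = 5) :
    1 - Matrix.of (fun i j => ((2 / 5 * (y i * y j) : ℝ) : ℂ)) ∈
      Matrix.unitaryGroup (Fin n) ℂ := by
  set Q : Matrix (Fin n) (Fin n) ℂ := Matrix.of (fun i j => ((2 / 5 * (y i * y j) : ℝ) : ℂ)) with hQ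
  have hs : star Q = Q := by
    ext i j
    simp [Q, Matrix.star_apply, mul_comm]
  have hQQ : Q * Q = 2 • Q := by
    ext i j
    rw [Matrix.mul_apply]
    simp only [Q, Matrix.of_apply, Matrix.smul_apply]
    have : ∑ k, 2 / 5 * (y i * y k) * (2 / 5 * (y k * y j)) = 2 • (2 / 5 * (y i * y j)) := by
      calc _ = 4 / 25 * (y i * y j) * ∑ k, y k ^ 2 := by
            rw [Finset.mul_sum]; exact Finset.sum_congr rfl fun k _ => by ring
        _ = _ := by rw [hy]; simp; ring
    exact_mod_cast this
  rw [Matrix.mem_unitaryGroup_iff, star_sub, star_one, hs, mul_sub, sub_mul, sub_mul, hQQ]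
  simp [two_smul]

namespace IsHaarRow

variable {Ω : Type*} [MeasurableSpace Ω] {P : Measure Ω} {n : ℕ} {z : Ω → Fin n → ℂ}

theorem normSq_le_one (h : IsHaarRow P z) (ω : Ω) (i : Fin n) : Complex.normSq (z ω i) ≤ 1 := by
  rw [← h.sum_normSq ω]
  exact Finset.single_le_sum (f := fun i => Complex.normSq (z ω i))
    (fun _ _ => Complex.normSq_nonneg _) (Finset.mem_univ i)

theorem measurable_normSq (h : IsHaarRow P z) (i : Fin n) :
    Measurable fun ω => Complex.normSq (z ω i) :=
  Complex.continuous_normSq.measurable.comp ((measurable_pi_apply i).comp h.measurable)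

theorem integrable_prod [IsProbabilityMeasure P] (h : IsHaarRow P z) {ι : Type*} [Fintype ι]
    (i : ι → Fin n) :
    Integrable (fun ω => ∏ r, Complex.normSq (z ω (i r))) P := by
  refine Integrable.of_bound (C := 1)
    (Finset.measurable_fun_prod _ fun r _ => h.measurable_normSq (i r)).aestronglyMeasurable
    (Filter.Eventually.of_forall fun ω => ?_)
  rw [Real.norm_of_nonneg (Finset.prod_nonneg fun _ _ => Complex.normSq_nonneg _)]
  exact Finset.prod_le_one (fun _ _ => Complex.normSq_nonneg _) fun r _ => h.normSq_le_one ω _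

theorem integrable_pow [IsProbabilityMeasure P] (h : IsHaarRow P z) (i : Fin n) (m : ℕ) :
    Integrable (fun ω => Complex.normSq (z ω i) ^ m) P := by
  simpa using h.integrable_prod (fun _ : Fin m => i)

theorem integrable_pow_mul [IsProbabilityMeasure P] (h : IsHaarRow P z) (i j : Fin n) (m : ℕ) :
    Integrable (fun ω => Complex.normSq (z ω i) ^ m * Complex.normSq (z ω j)) P := by
  simpa [Fin.prod_univ_castSucc] using
    h.integrable_prod (Fin.snoc (α := fun _ => Fin n) (fun _ : Fin m => i) j)

theorem integral_perm (h : IsHaarRow P z) (σ : Equiv.Perm (Fin n)) {f : (Fin n → ℂ) → ℝ}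
    (hf : Measurable f) : ∫ ω, f (fun i => z ω (σ i)) ∂P = ∫ ω, f (z ω) ∂P := by
  have hV : Equiv.Perm.permMatrix ℂ σ⁻¹ ∈ Matrix.unitaryGroup (Fin n) ℂ := by
    rw [Matrix.mem_unitaryGroup_iff, Matrix.star_eq_conjTranspose, Matrix.conjTranspose_permMatrix,
      ← Matrix.permMatrix_mul]
    simp
  rw [← h.integral_vecMul _ hV f hf]
  simp only [Matrix.vecMul_permMatrix]
  rfl

theorem integral_rotation_pow (h : IsHaarRow P z) {a b : Fin n} (hab : a ≠ b) (ε : ℝ)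
    (hε : ε ^ 2 = 1) (m : ℕ) :
    ∫ ω, Complex.normSq (-(3 / 5) * z ω a + (ε : ℂ) * (4 / 5) * z ω b) ^ m ∂P =
      ∫ ω, Complex.normSq (z ω a) ^ m ∂P := by
  set y : Fin n → ℝ := Pi.single a 2 - Pi.single b ε with hy
  have hya : y a = 2 := by simp [hy, hab]
  have hyb : y b = -ε := by simp [hy, hab.symm]
  have hyc : ∀ c, c ≠ a ∧ c ≠ b → y c = 0 := fun c hc => by simp [hy, hc.1, hc.2]
  have hV := one_sub_vecMulVec_mem_unitaryGroup y (by
    rw [Fintype.sum_eq_add a b hab (fun c hc => by rw [hyc c hc]; norm_num), hya, hyb, neg_sq, hε]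
    norm_num)
  rw [← h.integral_vecMul _ hV (fun x => Complex.normSq (x a) ^ m)
    ((Complex.continuous_normSq.measurable.comp (measurable_pi_apply a)).pow_const m)]
  refine integral_congr_ae (Filter.Eventually.of_forall fun ω => ?_)
  simp only
  congr 2
  rw [Matrix.vecMul_sub, Matrix.vecMul_one, Pi.sub_apply, Matrix.vecMul, dotProduct,
    Fintype.sum_eq_add a b hab (fun c hc => by simp [hyc c hc])]
  simp [hya, hyb]
  ring

theorem integral_pow_eq (h : IsHaarRow P z) (a b : Fin n) (m : ℕ) :
    ∫ ω, Complex.normSq (z ω a) ^ m ∂P = ∫ ω, Complex.normSq (z ω b) ^ m ∂P := by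
  simpa using h.integral_perm (Equiv.swap b a) (f := fun x => Complex.normSq (x b) ^ m)
    ((Complex.continuous_normSq.measurable.comp (measurable_pi_apply b)).pow_const m)

end IsHaarRow

theorem IsHaarRow.exists_pow_le_mixed (l : ℕ) : ∃ K : ℝ, 0 ≤ K ∧
    ∀ {Ω : Type} [MeasurableSpace Ω] {P : Measure Ω} [IsProbabilityMeasure P] {n : ℕ}
      {z : Ω → Fin n → ℂ}, IsHaarRow P z → ∀ a b : Fin n, a ≠ b →
      ∫ ω, Complex.normSq (z ω a) ^ (l + 2) ∂P ≤
        K * ∫ ω, Complex.normSq (z ω a) ^ (l + 1) * Complex.normSq (z ω b) ∂P := by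
  obtain ⟨K, hK, hle⟩ := normSq_rotation_pow_le l
  refine ⟨625 / 288 * K, by positivity, fun {Ω} _ {P} _ {n} {z} h a b hab => ?_⟩
  have hp := h.integral_rotation_pow hab 1 (by norm_num) (l + 2)
  have hq := h.integral_rotation_pow hab (-1) (by norm_num) (l + 2)
  simp only [Complex.ofReal_one, one_mul, Complex.ofReal_neg, neg_mul, ← sub_eq_add_neg] at hp hq
  have hmeas : ∀ c : ℂ, Measurable fun ω => Complex.normSq (-(3 / 5 * z ω a) + c * z ω b) ^ (l + 2) :=
    fun c => by
      have ha := (measurable_pi_apply a).comp h.measurable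
      have hb := (measurable_pi_apply b).comp h.measurable
      exact (Complex.continuous_normSq.measurable.comp
        ((ha.const_mul (3 / 5)).neg.add (hb.const_mul c))).pow_const _
  have hI : ∀ c : ℂ, ‖c‖ ≤ 1 →
      Integrable (fun ω => Complex.normSq (-(3 / 5 * z ω a) + c * z ω b) ^ (l + 2)) P := by
    intro c hc
    refine Integrable.of_bound (C := 4 ^ (l + 2)) (hmeas c).aestronglyMeasurable
      (Filter.Eventually.of_forall fun ω => ?_)
    have hn : ∀ i, ‖z ω i‖ ≤ 1 := fun i => by
      have := h.normSq_le_one ω i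
      rw [Complex.normSq_eq_norm_sq] at this
      exact (sq_le_one_iff₀ (norm_nonneg _)).1 this
    rw [Real.norm_of_nonneg (pow_nonneg (Complex.normSq_nonneg _) _), Complex.normSq_eq_norm_sq]
    have : ‖-(3 / 5 * z ω a) + c * z ω b‖ ≤ 2 := by
      refine (norm_add_le _ _).trans ?_
      rw [norm_neg, norm_mul, norm_mul]
      have e1 : ‖(3 / 5 : ℂ)‖ ≤ 1 := by norm_num
      have e2 := mul_le_one₀ e1 (norm_nonneg _) (hn a)
      have e3 := mul_le_one₀ hc (norm_nonneg _) (hn b)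
      linarith
    refine pow_le_pow_left₀ (by positivity) ?_ _
    nlinarith [norm_nonneg (-(3 / 5 * z ω a) + c * z ω b)]
  have hpI := hI (4 / 5) (by norm_num)
  have hqI := hI (-(4 / 5)) (by norm_num)
  simp only [neg_mul, ← sub_eq_add_neg] at hqI
  have hsym : ∫ ω, Complex.normSq (z ω a) * Complex.normSq (z ω b) ^ (l + 1) ∂P =
      ∫ ω, Complex.normSq (z ω a) ^ (l + 1) * Complex.normSq (z ω b) ∂P := by
    have hw : ∀ i : Fin n, Measurable fun x : Fin n → ℂ => Complex.normSq (x i) := fun i =>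
      Complex.continuous_normSq.measurable.comp (measurable_pi_apply i)
    have := h.integral_perm (Equiv.swap a b)
      (f := fun x => Complex.normSq (x a) ^ (l + 1) * Complex.normSq (x b))
      (((hw a).pow_const _).mul (hw b))
    simpa [mul_comm] using this
  have hIab := h.integrable_pow_mul a b (l + 1)
  have hIba : Integrable (fun ω => Complex.normSq (z ω a) * Complex.normSq (z ω b) ^ (l + 1)) P := by
    simpa [mul_comm] using h.integrable_pow_mul b a (l + 1)
  have hmono := integral_mono (hpI.add hqI)
    (((((h.integrable_pow a (l + 2)).const_mul ((9 / 25) ^ (l + 2))).add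
      ((h.integrable_pow b (l + 2)).const_mul ((16 / 25) ^ (l + 2)))).const_mul 2).add
      ((hIab.add hIba).const_mul K)) (fun ω => by
        simpa only [Pi.add_apply, neg_mul] using hle (z ω a) (z ω b))
  rw [integral_add' hpI hqI, hp, hq, integral_add' (by
      exact ((((h.integrable_pow a (l + 2)).const_mul ((9 / 25) ^ (l + 2))).add
      ((h.integrable_pow b (l + 2)).const_mul ((16 / 25) ^ (l + 2)))).const_mul 2)) (by
      exact ((hIab.add hIba).const_mul K)), integral_const_mul, integral_const_mul,
    integral_add' ((h.integrable_pow a (l + 2)).const_mul _) ((h.integrable_pow b (l + 2)).const_mul _),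
    integral_add' hIab hIba, integral_const_mul, integral_const_mul, hsym,
    ← h.integral_pow_eq a b] at hmono
  have e1 : ((9 : ℝ) / 25) ^ (l + 2) ≤ (9 / 25) ^ 2 :=
    pow_le_pow_of_le_one (by norm_num) (by norm_num) (by omega)
  have e2 : ((16 : ℝ) / 25) ^ (l + 2) ≤ (16 / 25) ^ 2 :=
    pow_le_pow_of_le_one (by norm_num) (by norm_num) (by omega)
  have h0 : 0 ≤ ∫ ω, Complex.normSq (z ω a) ^ (l + 2) ∂P :=
    integral_nonneg fun ω => pow_nonneg (Complex.normSq_nonneg _) _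
  have e3 := mul_le_mul_of_nonneg_right e1 h0
  have e4 := mul_le_mul_of_nonneg_right e2 h0
  linarith

theorem IsHaarRow.exists_integral_pow_le {Ω : Type} [MeasurableSpace Ω] {P : Measure Ω}
    [IsProbabilityMeasure P] {z : (n : ℕ) → Ω → Fin (n + 1) → ℂ} (h : ∀ n, IsHaarRow P (z n))
    (m : ℕ) : ∃ C : ℝ, 0 ≤ C ∧ ∀ n a,
      ∫ ω, Complex.normSq (z n ω a) ^ m ∂P ≤ C / (n + 1) ^ m := by
  induction m with
  | zero => exact ⟨1, by norm_num, fun n a => by simp⟩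
  | succ m ih =>
    cases m with
    | zero =>
      refine ⟨1, by norm_num, fun n a => ?_⟩
      have hs : ∑ i, ∫ ω, Complex.normSq (z n ω i) ^ 1 ∂P = 1 := by
        rw [← integral_finsetSum _ fun i _ => (h n).integrable_pow i 1]
        simp [(h n).sum_normSq]
      rw [Finset.sum_congr rfl fun i _ => (h n).integral_pow_eq i a 1] at hs
      simp only [Finset.sum_const, Finset.card_univ, Fintype.card_fin, nsmul_eq_mul] at hs
      push_cast at hs
      rw [le_div_iff₀ (by positivity)]
      simp only [zero_add, pow_one] at hs ⊢
      linarith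
    | succ l =>
      obtain ⟨C, hC, hm⟩ := ih
      obtain ⟨K, hK, hmix⟩ := IsHaarRow.exists_pow_le_mixed l
      refine ⟨2 * K * C + 1, by positivity, fun n a => ?_⟩
      rcases Nat.eq_zero_or_pos n with rfl | hn
      · have : ∀ ω, Complex.normSq (z 0 ω a) = 1 := fun ω => by
          have := (h 0).sum_normSq ω
          rw [Fin.sum_univ_one] at this
          rwa [show a = 0 from Fin.ext (by omega)]
        simp [this]
        positivity
      · have hsum : ∑ b ∈ Finset.univ.erase a,
            ∫ ω, Complex.normSq (z n ω a) ^ (l + 1) * Complex.normSq (z n ω b) ∂P ≤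
            ∫ ω, Complex.normSq (z n ω a) ^ (l + 1) ∂P := by
          rw [← integral_finsetSum _ fun b _ => (h n).integrable_pow_mul a b (l + 1)]
          refine integral_mono (integrable_finsetSum _ fun b _ =>
            (h n).integrable_pow_mul a b (l + 1)) ((h n).integrable_pow a (l + 1)) fun ω => ?_
          simp only [← Finset.mul_sum]
          refine mul_le_of_le_one_right (pow_nonneg (Complex.normSq_nonneg _) _) ?_
          rw [← (h n).sum_normSq ω]
          exact Finset.sum_le_sum_of_subset_of_nonneg (Finset.erase_subset _ _)
            fun _ _ _ => Complex.normSq_nonneg _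
        have hsum2 := Finset.sum_le_sum (s := Finset.univ.erase a) fun b hb =>
          hmix (h n) a b (Finset.ne_of_mem_erase hb).symm
        rw [Finset.sum_const, Finset.card_erase_of_mem (Finset.mem_univ a), Finset.card_univ,
          Fintype.card_fin, ← Finset.mul_sum, nsmul_eq_mul, Nat.add_sub_cancel] at hsum2
        have e1 := hsum2.trans (mul_le_mul_of_nonneg_left (hsum.trans (hm n a)) hK)
        have hn1 : (1 : ℝ) ≤ n := by exact_mod_cast hn
        set I := ∫ ω, Complex.normSq (z n ω a) ^ (l + 2) ∂P
        have hI : 0 ≤ I := integral_nonneg fun ω => pow_nonneg (Complex.normSq_nonneg _) _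
        have e2 : (n + 1) * I ≤ 2 * (K * (C / (n + 1) ^ (l + 1))) := by nlinarith
        have e3 : I ≤ 2 * K * C / (n + 1) ^ (l + 2) := by
          rw [le_div_iff₀ (by positivity)]
          have := mul_le_mul_of_nonneg_right e2 (by positivity : (0 : ℝ) ≤ (n + 1) ^ (l + 1))
          calc I * ((n : ℝ) + 1) ^ (l + 2) = (n + 1) * I * (n + 1) ^ (l + 1) := by ring
            _ ≤ _ := this
            _ = _ := by field_simp
        exact e3.trans (by gcongr; linarith)

theorem prod_pow_le_sum_pow {ι : Type*} [Fintype ι] [Nonempty ι] (u : ι → ℝ) (hu : ∀ r, 0 ≤ u r)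
    (j : ι → ℕ) : ∏ r, u r ^ j r ≤ ∑ r, u r ^ ∑ s, j s := by
  obtain ⟨r, hr⟩ := Finite.exists_max u
  calc ∏ s, u s ^ j s ≤ ∏ s, u r ^ j s :=
        Finset.prod_le_prod (fun s _ => pow_nonneg (hu s) _)
          fun s _ => pow_le_pow_left₀ (hu s) (hr s) _
    _ = u r ^ ∑ s, j s := Finset.prod_pow_eq_pow_sum _ _ _
    _ ≤ _ := Finset.single_le_sum (f := fun r => u r ^ ∑ s, j s)
        (fun s _ => pow_nonneg (hu s) _) (Finset.mem_univ r)

theorem exists_perm_comp_eq {ι α : Type*} [Finite α] {i i' : ι → α} (hi : Function.Injective i)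
    (hi' : Function.Injective i') : ∃ σ : Equiv.Perm α, ∀ r, σ (i r) = i' r := by
  let e : Set.range i ≃ Set.range i' :=
    (Equiv.ofInjective i hi).symm.trans (Equiv.ofInjective i' hi')
  have := Fintype.ofFinite α
  refine ⟨Equiv.extendSubtype e, fun r => ?_⟩
  rw [Equiv.extendSubtype_apply_of_mem e (i r) ⟨r, rfl⟩]
  have : (⟨i r, r, rfl⟩ : Set.range i) = Equiv.ofInjective i hi r := rfl
  rw [this]
  simp [e]

theorem card_not_injective_mul_le (ι α : Type*) [Fintype ι] [Fintype α] :
    ((Finset.univ.filter fun i : ι → α => ¬ Function.Injective i).card : ℝ) * Fintype.card α ≤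
      (Fintype.card ι : ℝ) ^ 2 * (Fintype.card α : ℝ) ^ Fintype.card ι := by
  have h1 : (Finset.univ.filter fun i : ι → α => ¬ Function.Injective i) ⊆
      (Finset.univ.filter fun p : ι × ι => p.1 ≠ p.2).biUnion fun p =>
        Finset.univ.filter fun i : ι → α => i p.1 = i p.2 := by
    intro i hi
    replace hi := (Finset.mem_filter.1 hi).2
    simp only [Function.Injective] at hi
    push Not at hi
    obtain ⟨r, s, h, hrs⟩ := hi
    simp only [Finset.mem_biUnion, Finset.mem_filter, Finset.mem_univ, true_and]
    exact ⟨(r, s), hrs, h⟩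
  have h2 : ∀ p : ι × ι, p.1 ≠ p.2 →
      (Finset.univ.filter fun i : ι → α => i p.1 = i p.2).card * Fintype.card α ≤
        Fintype.card α ^ Fintype.card ι := by
    intro p hp
    rw [← Finset.card_univ (α := α), ← Finset.card_product, ← Finset.card_univ (α := ι),
      Finset.card_univ (α := α), Finset.card_univ (α := ι), ← Fintype.card_fun, ← Finset.card_univ]
    refine Finset.card_le_card_of_injOn (fun q => Function.update q.1 p.1 q.2)
      (fun _ _ => Finset.mem_coe.2 (Finset.mem_univ _)) ?_
    rintro ⟨i, a⟩ hi ⟨i', a'⟩ hi' h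
    simp only [Finset.coe_product, Set.mem_prod, Finset.mem_coe, Finset.mem_filter,
      Finset.mem_univ, true_and, and_true] at hi hi' h
    have ha : a = a' := by simpa using congrFun h p.1
    have hne : ∀ r, r ≠ p.1 → i r = i' r := fun r hr => by simpa [hr] using congrFun h r
    refine Prod.ext (funext fun r => ?_) ha
    by_cases hr : r = p.1
    · simp only [hr, hi, hi', hne _ hp.symm]
    · exact hne r hr
  have h3 := Finset.card_le_card h1 |>.trans Finset.card_biUnion_le
  have h4 : (Finset.univ.filter fun i : ι → α => ¬ Function.Injective i).card * Fintype.card α ≤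
      Fintype.card ι ^ 2 * Fintype.card α ^ Fintype.card ι := by
    refine (Nat.mul_le_mul_right _ h3).trans ?_
    rw [Finset.sum_mul]
    refine (Finset.sum_le_sum fun p hp => h2 p (Finset.mem_filter.1 hp).2).trans ?_
    rw [Finset.sum_const, smul_eq_mul]
    refine Nat.mul_le_mul_right _ ((Finset.card_filter_le _ _).trans ?_)
    simp [sq]
  exact_mod_cast h4

/-- A mean-zero function of a tuple of indices which is invariant under permutations of the
alphabet is controlled by its values at tuples with a repetition. -/
theorem sum_abs_le_of_perm_invariant {ι α : Type*} [Fintype ι] [Fintype α]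
    (d : (ι → α) → ℝ) (hd : ∀ (σ : Equiv.Perm α) (i : ι → α), d (fun r => σ (i r)) = d i)
    (h0 : ∑ i, d i = 0) (B : ℝ) (hB : ∀ i, |d i| ≤ B) :
    (∑ i, |d i|) * Fintype.card α ≤
      2 * B * ((Fintype.card ι : ℝ) ^ 2 * (Fintype.card α : ℝ) ^ Fintype.card ι) := by
  have hinj : ∑ i ∈ Finset.univ.filter (fun i : ι → α => Function.Injective i), |d i| =
      |∑ i ∈ Finset.univ.filter (fun i : ι → α => Function.Injective i), d i| := by
    rcases (Finset.univ.filter fun i : ι → α => Function.Injective i).eq_empty_or_nonempty with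
      h | ⟨i₀, hi₀⟩
    · simp [h]
    · have hc : ∀ i ∈ Finset.univ.filter (fun i : ι → α => Function.Injective i), d i = d i₀ := by
        intro i hi
        obtain ⟨σ, hσ⟩ := exists_perm_comp_eq (Finset.mem_filter.1 hi₀).2 (Finset.mem_filter.1 hi).2
        rw [← hd σ i₀]
        exact congrArg d (funext fun r => (hσ r).symm)
      rw [Finset.sum_congr rfl hc, Finset.sum_congr rfl fun i hi => by rw [hc i hi]]
      simp [abs_mul]
  have hsplit := Finset.sum_filter_add_sum_filter_not Finset.univ
    (fun i : ι → α => Function.Injective i) d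
  have hsplit' := Finset.sum_filter_add_sum_filter_not Finset.univ
    (fun i : ι → α => Function.Injective i) fun i => |d i|
  have hle : ∑ i ∈ Finset.univ.filter (fun i : ι → α => ¬ Function.Injective i), |d i| ≤
      (Finset.univ.filter fun i : ι → α => ¬ Function.Injective i).card * B := by
    rw [← nsmul_eq_mul]
    exact Finset.sum_le_card_nsmul _ _ _ fun i _ => hB i
  have habs := Finset.abs_sum_le_sum_abs d
    (Finset.univ.filter (fun i : ι → α => ¬ Function.Injective i))
  rw [h0] at hsplit
  rw [eq_neg_of_add_eq_zero_left hsplit, abs_neg] at hinj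
  rcases isEmpty_or_nonempty (ι → α) with hE | ⟨⟨i⟩⟩
  · have hcard : Fintype.card (ι → α) = 0 := Fintype.card_eq_zero
    rw [Fintype.card_fun] at hcard
    have : (Fintype.card α : ℝ) ^ Fintype.card ι = 0 := by exact_mod_cast hcard
    simp [this]
  have hB0 : 0 ≤ B := (abs_nonneg _).trans (hB i)
  have hcard := mul_le_mul_of_nonneg_left (card_not_injective_mul_le ι α)
    (by positivity : 0 ≤ 2 * B)
  have : ∑ i, |d i| ≤
      2 * ((Finset.univ.filter fun i : ι → α => ¬ Function.Injective i).card * B) := by linarith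
  calc _ ≤ _ := mul_le_mul_of_nonneg_right this (Nat.cast_nonneg _)
    _ = 2 * B * (((Finset.univ.filter fun i : ι → α => ¬ Function.Injective i).card : ℝ) *
      Fintype.card α) := by ring
    _ ≤ _ := hcard

theorem sum_mul_apply_of_perm_invariant {ι : Type*} [Fintype ι] {n : ℕ}
    (d : (ι → Fin (n + 1)) → ℝ)
    (hd : ∀ (σ : Equiv.Perm (Fin (n + 1))) (i : ι → Fin (n + 1)), d (fun r => σ (i r)) = d i)
    (g : Fin (n + 1) → ℝ) (r : ι) :
    ∑ i, d i * g (i r) = (∑ i, d i) * (1 / (n + 1 : ℝ) * ∑ a, g a) := by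
  have h1 : ∀ c : Fin (n + 1), ∑ i, d i * g (i r) = ∑ i, d i * g (i r + c) := by
    intro c
    rw [← Equiv.sum_comp (Equiv.arrowCongr (Equiv.refl ι) (Equiv.addRight c))]
    refine Finset.sum_congr rfl fun i _ => ?_
    rw [← hd (Equiv.addRight c) i]
    rfl
  have h2 : ((n : ℝ) + 1) * ∑ i, d i * g (i r) = (∑ i, d i) * ∑ a, g a := by
    calc ((n : ℝ) + 1) * ∑ i, d i * g (i r) = ∑ c : Fin (n + 1), ∑ i, d i * g (i r) := by simp
      _ = ∑ c : Fin (n + 1), ∑ i, d i * g (i r + c) := Finset.sum_congr rfl fun c _ => h1 c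
      _ = _ := by
        rw [Finset.sum_comm, Finset.sum_mul]
        refine Finset.sum_congr rfl fun i _ => ?_
        rw [← Finset.mul_sum, ← Equiv.sum_comp (Equiv.addLeft (i r)) g]
        rfl
  field_simp
  linarith

theorem IsHaarRow.integral_prod_perm {Ω : Type*} [MeasurableSpace Ω] {P : Measure Ω} {n : ℕ}
    {z : Ω → Fin n → ℂ} (h : IsHaarRow P z) {ι : Type*} [Fintype ι] (σ : Equiv.Perm (Fin n))
    (i : ι → Fin n) :
    ∫ ω, ∏ r, Complex.normSq (z ω (σ (i r))) ∂P = ∫ ω, ∏ r, Complex.normSq (z ω (i r)) ∂P :=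
  h.integral_perm σ (f := fun x => ∏ r, Complex.normSq (x (i r)))
    (Finset.measurable_fun_prod _ fun _ _ =>
      Complex.continuous_normSq.measurable.comp (measurable_pi_apply _))

theorem IsHaarRow.sum_integral_prod {Ω : Type*} [MeasurableSpace Ω] {P : Measure Ω}
    [IsProbabilityMeasure P] {n : ℕ} {z : Ω → Fin n → ℂ} (h : IsHaarRow P z) (ι : Type*)
    [Fintype ι] : ∑ i : ι → Fin n, ∫ ω, ∏ r, Complex.normSq (z ω (i r)) ∂P = 1 := by
  rw [← integral_finsetSum _ fun i _ => h.integrable_prod i]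
  have : ∀ ω, ∑ i : ι → Fin n, ∏ r, Complex.normSq (z ω (i r)) = 1 := fun ω => by
    rw [← Fintype.piFinset_univ, ← Finset.prod_univ_sum (fun _ : ι => Finset.univ)
      fun _ a => Complex.normSq (z ω a)]
    simp [h.sum_normSq]
  simp [this]

theorem IsHaarRow.exists_sum_abs_le {Ω : Type} [MeasurableSpace Ω] {P : Measure Ω}
    [IsProbabilityMeasure P] {z : (n : ℕ) → Ω → Fin (n + 1) → ℂ} (h : ∀ n, IsHaarRow P (z n))
    (ι : Type) [Fintype ι] [Nonempty ι] : ∃ C : ℝ, 0 ≤ C ∧ ∀ n,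
      ∑ i : ι → Fin (n + 1), |∫ ω, ∏ r, Complex.normSq (z n ω (i r)) ∂P -
        1 / (n + 1) ^ Fintype.card ι| ≤ C / (n + 1) := by
  obtain ⟨C, hC, hm⟩ := IsHaarRow.exists_integral_pow_le h (Fintype.card ι)
  set m := Fintype.card ι with hmdef
  refine ⟨2 * (m * C + 1) * (m : ℝ) ^ 2, by positivity, fun n => ?_⟩
  have hN : (0 : ℝ) < (n + 1) ^ m := by positivity
  have key := sum_abs_le_of_perm_invariant
    (fun i : ι → Fin (n + 1) => ∫ ω, ∏ r, Complex.normSq (z n ω (i r)) ∂P - 1 / (n + 1 : ℝ) ^ m)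
    (fun σ i => by simp only [(h n).integral_prod_perm σ i])
    (by
      rw [Finset.sum_sub_distrib, (h n).sum_integral_prod]
      simp [← hmdef, hN.ne'])
    ((m * C + 1) / (n + 1) ^ m) (fun i => by
      have h0 : 0 ≤ ∫ ω, ∏ r, Complex.normSq (z n ω (i r)) ∂P :=
        integral_nonneg fun ω => Finset.prod_nonneg fun _ _ => Complex.normSq_nonneg _
      have h1 : ∫ ω, ∏ r, Complex.normSq (z n ω (i r)) ∂P ≤ m * C / (n + 1) ^ m := by
        calc ∫ ω, ∏ r, Complex.normSq (z n ω (i r)) ∂P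
            ≤ ∫ ω, ∑ r, Complex.normSq (z n ω (i r)) ^ m ∂P := by
              refine integral_mono ((h n).integrable_prod i)
                (integrable_finsetSum _ fun r _ => (h n).integrable_pow (i r) m) fun ω => ?_
              simpa using prod_pow_le_sum_pow (fun r => Complex.normSq (z n ω (i r)))
                (fun r => Complex.normSq_nonneg _) fun _ => 1
          _ = ∑ r, ∫ ω, Complex.normSq (z n ω (i r)) ^ m ∂P :=
              integral_finsetSum _ fun r _ => (h n).integrable_pow (i r) m
          _ ≤ ∑ r : ι, C / (n + 1) ^ m := Finset.sum_le_sum fun r _ => hm n (i r)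
          _ = m * C / (n + 1) ^ m := by
              rw [Finset.sum_const, Finset.card_univ, ← hmdef, nsmul_eq_mul, mul_div_assoc]
      have h2 : 0 < 1 / ((n : ℝ) + 1) ^ m := by positivity
      have h3 : 0 ≤ m * C / ((n : ℝ) + 1) ^ m := by positivity
      rw [add_div, abs_le]
      constructor <;> linarith)
  rw [Fintype.card_fin, ← hmdef] at key
  push_cast at key
  rw [le_div_iff₀ (by positivity)]
  refine key.trans (le_of_eq ?_)
  field_simp

section Comparison

variable {Ω : Type} [MeasurableSpace Ω] {P : Measure Ω} {n : ℕ}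
  {z : Ω → Fin (n + 1) → ℂ} {D : Ω → Fin (n + 1) → ℝ} {ι : Type} [Fintype ι]

theorem integrable_pow_of_integrable_sum (hD : Measurable D) {q : ℕ}
    (hint : Integrable (fun ω => ∑ a, D ω a ^ (2 * q)) P) (a : Fin (n + 1)) :
    Integrable (fun ω => D ω a ^ (2 * q)) P := by
  refine hint.mono' (((measurable_pi_apply a).comp hD).pow_const _).aestronglyMeasurable
    (Filter.Eventually.of_forall fun ω => ?_)
  rw [Real.norm_of_nonneg ((even_two_mul q).pow_nonneg _)]
  exact Finset.single_le_sum (f := fun a => D ω a ^ (2 * q))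
    (fun _ _ => (even_two_mul q).pow_nonneg _) (Finset.mem_univ a)

theorem abs_prod_pow_le [Nonempty ι] {q : ℕ} {j : ι → ℕ} (hj : ∑ r, j r = 2 * q)
    (u : ι → ℝ) : |∏ r, u r ^ j r| ≤ ∑ r, u r ^ (2 * q) := by
  rw [Finset.abs_prod]
  simp only [abs_pow]
  refine (prod_pow_le_sum_pow (fun r => |u r|) (fun r => abs_nonneg _) j).trans (le_of_eq ?_)
  rw [hj]
  simp only [(even_two_mul q).pow_abs]

theorem measurable_prod_pow (hD : Measurable D) (i : ι → Fin (n + 1)) (j : ι → ℕ) :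
    Measurable fun ω => ∏ r, D ω (i r) ^ j r :=
  Finset.measurable_fun_prod _ fun r _ => ((measurable_pi_apply (i r)).comp hD).pow_const _

theorem integrable_prod_pow [Nonempty ι] (hD : Measurable D) {q : ℕ}
    (hint : Integrable (fun ω => ∑ a, D ω a ^ (2 * q)) P) {j : ι → ℕ}
    (hj : ∑ r, j r = 2 * q) (i : ι → Fin (n + 1)) :
    Integrable (fun ω => ∏ r, D ω (i r) ^ j r) P := by
  refine (integrable_finsetSum Finset.univ fun r _ =>
    integrable_pow_of_integrable_sum hD hint (i r)).mono'
    (measurable_prod_pow hD i j).aestronglyMeasurable (Filter.Eventually.of_forall fun ω => ?_)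
  exact abs_prod_pow_le hj fun r => D ω (i r)

theorem prod_sum_eq_sum_prod_mul (w x : Fin (n + 1) → ℝ) (j : ι → ℕ) :
    ∏ r, ∑ a, w a * x a ^ j r = ∑ i : ι → Fin (n + 1), (∏ r, w (i r)) * ∏ r, x (i r) ^ j r := by
  rw [Finset.prod_univ_sum, Fintype.piFinset_univ]
  simp only [Finset.prod_mul_distrib]

variable [IsProbabilityMeasure P]

theorem IsHaarRow.integrable_prod_mul [Nonempty ι] (h : IsHaarRow P z) (hD : Measurable D)
    (hind : IndepFun z D P) {q : ℕ} (hint : Integrable (fun ω => ∑ a, D ω a ^ (2 * q)) P)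
    {j : ι → ℕ} (hj : ∑ r, j r = 2 * q) (i : ι → Fin (n + 1)) :
    Integrable (fun ω => (∏ r, Complex.normSq (z ω (i r))) * ∏ r, D ω (i r) ^ j r) P ∧
    ∫ ω, (∏ r, Complex.normSq (z ω (i r))) * ∏ r, D ω (i r) ^ j r ∂P =
      (∫ ω, ∏ r, Complex.normSq (z ω (i r)) ∂P) * ∫ ω, ∏ r, D ω (i r) ^ j r ∂P := by
  have hφ : Measurable fun x : Fin (n + 1) → ℂ => ∏ r, Complex.normSq (x (i r)) :=
    Finset.measurable_fun_prod _ fun _ _ =>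
      Complex.continuous_normSq.measurable.comp (measurable_pi_apply _)
  have hψ : Measurable fun x : Fin (n + 1) → ℝ => ∏ r, x (i r) ^ j r :=
    Finset.measurable_fun_prod _ fun _ _ => (measurable_pi_apply _).pow_const _
  have hind' := hind.comp hφ hψ
  have h1 := h.integrable_prod i
  have h2 := integrable_prod_pow hD hint hj i
  exact ⟨hind'.integrable_mul h1 h2,
    hind'.integral_fun_mul_eq_mul_integral h1.aestronglyMeasurable h2.aestronglyMeasurable⟩

theorem IsHaarRow.comparison [Nonempty ι] (h : IsHaarRow P z) (hD : Measurable D)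
    (hind : IndepFun z D P) {q : ℕ} (hint : Integrable (fun ω => ∑ a, D ω a ^ (2 * q)) P)
    {j : ι → ℕ} (hj : ∑ r, j r = 2 * q) :
    Integrable (fun ω => ∏ r, ∑ a, Complex.normSq (z ω a) * D ω a ^ j r) P ∧
    Integrable (fun ω => ∏ r, (1 / (n + 1 : ℝ) * ∑ a, D ω a ^ j r)) P ∧
    |∫ ω, ∏ r, ∑ a, Complex.normSq (z ω a) * D ω a ^ j r ∂P -
        ∫ ω, ∏ r, (1 / (n + 1 : ℝ) * ∑ a, D ω a ^ j r) ∂P| ≤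
      Fintype.card ι * (∑ i : ι → Fin (n + 1), |∫ ω, ∏ r, Complex.normSq (z ω (i r)) ∂P -
        1 / (n + 1) ^ Fintype.card ι|) *
          ∫ ω, (1 / (n + 1 : ℝ)) * ∑ a, D ω a ^ (2 * q) ∂P := by
  simp only [Finset.mul_sum _ _ (1 / ((n : ℝ) + 1)), prod_sum_eq_sum_prod_mul]
  have hI1 := fun i => h.integrable_prod_mul hD hind hint hj i
  have hI2 : ∀ i : ι → Fin (n + 1),
      Integrable (fun ω => (∏ _r : ι, 1 / ((n : ℝ) + 1)) * ∏ r, D ω (i r) ^ j r) P :=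
    fun i => (integrable_prod_pow hD hint hj i).const_mul _
  have hI3 := integrable_pow_of_integrable_sum hD hint
  refine ⟨integrable_finsetSum _ fun i _ => (hI1 i).1, integrable_finsetSum _ fun i _ => hI2 i, ?_⟩
  rw [integral_finsetSum _ fun i _ => (hI1 i).1, integral_finsetSum _ fun i _ => hI2 i,
    ← Finset.sum_sub_distrib, integral_finsetSum _ fun i _ => (hI3 i).const_mul _]
  simp only [(hI1 _).2, integral_const_mul, Finset.prod_const, Finset.card_univ, one_div_pow,
    ← sub_mul]
  calc _ ≤ ∑ i : ι → Fin (n + 1), |∫ ω, ∏ r, Complex.normSq (z ω (i r)) ∂P -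
          1 / (n + 1) ^ Fintype.card ι| * ∑ r, ∫ ω, D ω (i r) ^ (2 * q) ∂P := by
        refine (Finset.abs_sum_le_sum_abs _ _).trans (Finset.sum_le_sum fun i _ => ?_)
        rw [abs_mul]
        refine mul_le_mul_of_nonneg_left ?_ (abs_nonneg _)
        rw [← integral_finsetSum _ fun r _ => hI3 (i r)]
        refine abs_integral_le_integral_abs.trans
          (integral_mono (integrable_prod_pow hD hint hj i).abs
            (integrable_finsetSum _ fun r _ => hI3 (i r)) fun ω => ?_)
        exact abs_prod_pow_le hj fun r => D ω (i r)
    _ = _ := by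
        simp only [Finset.mul_sum]
        rw [Finset.sum_comm]
        simp only [← Finset.mul_sum]
        rw [Finset.sum_congr rfl fun r _ => sum_mul_apply_of_perm_invariant
          (fun i : ι → Fin (n + 1) => |∫ ω, ∏ r, Complex.normSq (z ω (i r)) ∂P -
            1 / (n + 1) ^ Fintype.card ι|)
          (fun σ i => by simp only [h.integral_prod_perm σ i])
          (fun a => ∫ ω, D ω a ^ (2 * q) ∂P) r]
        simp [mul_assoc]

end Comparison

theorem conj_diagonal_pow {m : ℕ} {V : Matrix (Fin m) (Fin m) ℂ}
    (hV : V ∈ Matrix.unitaryGroup (Fin m) ℂ) (d : Fin m → ℝ) (j : ℕ) :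
    (V * Matrix.diagonal (fun i => (d i : ℂ)) * star V) ^ j =
      V * Matrix.diagonal (fun i => ((d i ^ j : ℝ) : ℂ)) * star V := by
  have h1 : V * star V = 1 := Matrix.mem_unitaryGroup_iff.1 hV
  have h2 : star V * V = 1 := Matrix.mem_unitaryGroup_iff'.1 hV
  induction j with
  | zero => simp [h1]
  | succ j ih =>
    rw [pow_succ, ih]
    calc V * Matrix.diagonal (fun i => ((d i ^ j : ℝ) : ℂ)) * star V *
          (V * Matrix.diagonal (fun i => (d i : ℂ)) * star V)
        = V * Matrix.diagonal (fun i => ((d i ^ j : ℝ) : ℂ)) * (star V * V) *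
          Matrix.diagonal (fun i => (d i : ℂ)) * star V := by simp only [Matrix.mul_assoc]
      _ = _ := by
        rw [h2, Matrix.mul_one, Matrix.mul_assoc V, Matrix.diagonal_mul_diagonal]
        simp [pow_succ]

theorem trace_conj_diagonal_pow {m : ℕ} {V : Matrix (Fin m) (Fin m) ℂ}
    (hV : V ∈ Matrix.unitaryGroup (Fin m) ℂ) (d : Fin m → ℝ) (j : ℕ) :
    ((V * Matrix.diagonal (fun i => (d i : ℂ)) * star V) ^ j).trace =
      ((∑ i, d i ^ j : ℝ) : ℂ) := by
  rw [conj_diagonal_pow hV, Matrix.trace_mul_comm, ← Matrix.mul_assoc,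
    Matrix.mem_unitaryGroup_iff'.1 hV, Matrix.one_mul, Matrix.trace_diagonal]
  simp

theorem conj_diagonal_pow_apply_self {m : ℕ} {V : Matrix (Fin m) (Fin m) ℂ}
    (hV : V ∈ Matrix.unitaryGroup (Fin m) ℂ) (d : Fin m → ℝ) (j : ℕ) (a : Fin m) :
    ((V * Matrix.diagonal (fun i => (d i : ℂ)) * star V) ^ j) a a =
      ((∑ i, Complex.normSq (V a i) * d i ^ j : ℝ) : ℂ) := by
  rw [conj_diagonal_pow hV, Matrix.mul_apply]
  push_cast
  refine Finset.sum_congr rfl fun i _ => ?_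
  rw [Matrix.mul_diagonal, Matrix.star_apply, RCLike.star_def, ← Complex.mul_conj]
  ring

theorem isNewtonPair_corner {n : ℕ} {X U V : Matrix (Fin (n + 1)) (Fin (n + 1)) ℂ}
    {W : Matrix (Fin n) (Fin n) ℂ} (hU : U ∈ Matrix.unitaryGroup (Fin (n + 1)) ℂ)
    (hV : V ∈ Matrix.unitaryGroup (Fin (n + 1)) ℂ) (hW : W ∈ Matrix.unitaryGroup (Fin n) ℂ)
    {d lam : Fin (n + 1) → ℝ} {lamt : Fin n → ℝ}
    (hXU : X = U * Matrix.diagonal (fun i => (d i : ℂ)) * star U)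
    (hXV : X = V * Matrix.diagonal (fun i => (lam i : ℂ)) * star V)
    (hXW : X.submatrix Fin.castSucc Fin.castSucc =
      W * Matrix.diagonal (fun i => (lamt i : ℂ)) * star W) :
    IsNewtonPair (fun j => ∑ i, Complex.normSq (U (Fin.last n) i) * d i ^ j)
      (fun j => ∑ i, lam i ^ j - ∑ i, lamt i ^ j) := by
  refine ⟨by simp [sum_normSq_row_of_unitary hU], fun k => ?_⟩
  have h := newton_corner X k
  have h1 : ∀ j, (X ^ j) (Fin.last n) (Fin.last n) =
      ((∑ i, Complex.normSq (U (Fin.last n) i) * d i ^ j : ℝ) : ℂ) := fun j => by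
    rw [hXU, conj_diagonal_pow_apply_self hU]
  have h2 : ∀ j, (X ^ j).trace = ((∑ i, lam i ^ j : ℝ) : ℂ) := fun j => by
    rw [hXV, trace_conj_diagonal_pow hV]
  have h3 : ∀ j, ((X.submatrix Fin.castSucc Fin.castSucc) ^ j).trace =
      ((∑ i, lamt i ^ j : ℝ) : ℂ) := fun j => by
    rw [hXW, trace_conj_diagonal_pow hW]
  simp only [h1, h2, h3] at h
  exact_mod_cast h

theorem exists_abs_integral_sub_le {Ω : Type} [MeasurableSpace Ω] {P : Measure Ω}
    [IsProbabilityMeasure P] {z : (n : ℕ) → Ω → Fin (n + 1) → ℂ}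
    {D : (n : ℕ) → Ω → Fin (n + 1) → ℝ} (h : ∀ n, IsHaarRow P (z n))
    (hD : ∀ n, Measurable (D n)) (hind : ∀ n, IndepFun (z n) (D n) P) {q : ℕ} (hq : 1 ≤ q)
    (hint : ∀ n, Integrable (fun ω => ∑ a, D n ω a ^ (2 * q)) P) {B : ℝ}
    (hB : ∀ n : ℕ, ∫ ω, (1 / ((n : ℝ) + 1)) * ∑ a, D n ω a ^ (2 * q) ∂P ≤ B)
    {f : (ℕ → ℝ) → ℝ} (hf : f ∈ weightedPolys (2 * q)) :
    ∃ C : ℝ, ∀ n,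
      Integrable (fun ω => f fun j => ∑ a, Complex.normSq (z n ω a) * D n ω a ^ j) P ∧
      Integrable (fun ω => f fun j => 1 / ((n : ℝ) + 1) * ∑ a, D n ω a ^ j) P ∧
      |∫ ω, f (fun j => ∑ a, Complex.normSq (z n ω a) * D n ω a ^ j) ∂P -
        ∫ ω, f (fun j => 1 / ((n : ℝ) + 1) * ∑ a, D n ω a ^ j) ∂P| ≤ C / (n + 1) := by
  induction hf using Submodule.span_induction with
  | mem f hf =>
    obtain ⟨ι, _, j, hj, rfl⟩ := hf
    have : Nonempty ι := by
      by_contra hE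
      rw [not_nonempty_iff] at hE
      simp at hj
      omega
    obtain ⟨C, hC, hsum⟩ := IsHaarRow.exists_sum_abs_le h ι
    refine ⟨Fintype.card ι * C * B, fun n => ?_⟩
    obtain ⟨h1, h2, h3⟩ := (h n).comparison (hD n) (hind n) (hint n) hj
    refine ⟨h1, h2, h3.trans ?_⟩
    have h0 : 0 ≤ ∫ ω, (1 / ((n : ℝ) + 1)) * ∑ a, D n ω a ^ (2 * q) ∂P :=
      integral_nonneg fun ω => mul_nonneg (by positivity)
        (Finset.sum_nonneg fun _ _ => (even_two_mul q).pow_nonneg _)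
    calc _ ≤ Fintype.card ι * (C / (n + 1)) * B := by
          refine mul_le_mul (mul_le_mul_of_nonneg_left (hsum n) (Nat.cast_nonneg _)) (hB n) h0
            (by positivity)
      _ = _ := by ring
  | zero => exact ⟨0, fun n => by simp⟩
  | add f g _ _ hf hg =>
    obtain ⟨C, hC⟩ := hf
    obtain ⟨C', hC'⟩ := hg
    refine ⟨C + C', fun n => ?_⟩
    obtain ⟨h1, h2, h3⟩ := hC n
    obtain ⟨h1', h2', h3'⟩ := hC' n
    refine ⟨h1.add h1', h2.add h2', ?_⟩
    simp only [Pi.add_apply]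
    rw [integral_add h1 h1', integral_add h2 h2', add_sub_add_comm, add_div]
    exact (abs_add_le _ _).trans (add_le_add h3 h3')
  | smul c f _ hf =>
    obtain ⟨C, hC⟩ := hf
    refine ⟨|c| * C, fun n => ?_⟩
    obtain ⟨h1, h2, h3⟩ := hC n
    refine ⟨h1.const_mul c, h2.const_mul c, ?_⟩
    simp only [Pi.smul_apply, smul_eq_mul]
    rw [integral_const_mul, integral_const_mul, ← mul_sub, abs_mul, mul_div_assoc]
    exact mul_le_mul_of_nonneg_left h3 (abs_nonneg c)

/-- For each `N = n+1 ≥ 1`, let `X_N = U_N D_N U_N^*` where `U_N` is a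
Haar unitary random matrix and `D_N` an independent random real diagonal matrix; let
`lam n` be the ordered eigenvalues of `X_N`, `lamt n` the ordered eigenvalues of the
principal submatrix obtained by deleting the last row and column, `Mm n k` the `k`-th
moment of the empirical eigenvalue distribution `m_N`, `fc n` the free cumulants of
`m_N`, `Mκ n k = Σ λ_i^k − Σ λ̃_j^k` the moments of the Rayleigh measure `κ_N`, and
`Mτ n k = Σ_{ρ ∈ NC(k)} (k+1−|ρ|) fc_ρ(m_N)`.  Assume `sup_N E[M_k(m_N)] < ∞` for all
even `k`.  Then for every `k ≥ 1`, `E[M_k(κ_N)²] = E[M_k(τ_N)²] + O(1/N)`. -/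
theorem statement5
    {Ω : Type} [MeasurableSpace Ω] (Pr : Measure Ω) [IsProbabilityMeasure Pr]
    (U : (n : ℕ) → Ω → Matrix (Fin (n + 1)) (Fin (n + 1)) ℂ)
    (D : (n : ℕ) → Ω → (Fin (n + 1) → ℝ))
    (hUmeas : ∀ n, Measurable (U n))
    (hDmeas : ∀ n, Measurable (D n))
    (hUuni : ∀ n ω, U n ω ∈ Matrix.unitaryGroup (Fin (n + 1)) ℂ)
    -- `U_N` is Haar distributed on the unitary group:
    (hHaar : ∀ n, (Measure.map
      (fun ω => (⟨U n ω, hUuni n ω⟩ : Matrix.unitaryGroup (Fin (n + 1)) ℂ)) Pr).IsHaarMeasure)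
    -- `D_N` is independent of `U_N`:
    (hindep : ∀ n, IndepFun (U n) (D n) Pr)
    (X : (n : ℕ) → Ω → Matrix (Fin (n + 1)) (Fin (n + 1)) ℂ)
    (hX : ∀ n ω, X n ω = U n ω * Matrix.diagonal (fun i => (D n ω i : ℂ)) * star (U n ω))
    -- the ordered eigenvalues `λ_1 ≤ ⋯ ≤ λ_N` of `X_N`:
    (lam : (n : ℕ) → Ω → (Fin (n + 1) → ℝ))
    (hlam_mono : ∀ n ω, Monotone (lam n ω))
    (hlam_eig : ∀ n ω, ∃ V ∈ Matrix.unitaryGroup (Fin (n + 1)) ℂ,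
      X n ω = V * Matrix.diagonal (fun i => (lam n ω i : ℂ)) * star V)
    -- the ordered eigenvalues `λ̃_1 ≤ ⋯ ≤ λ̃_{N−1}` of the principal submatrix:
    (lamt : (n : ℕ) → Ω → (Fin n → ℝ))
    (hlamt_mono : ∀ n ω, Monotone (lamt n ω))
    (hlamt_eig : ∀ n ω, ∃ V ∈ Matrix.unitaryGroup (Fin n) ℂ,
      (X n ω).submatrix Fin.castSucc Fin.castSucc
        = V * Matrix.diagonal (fun j => (lamt n ω j : ℂ)) * star V)
    -- the moments of the empirical eigenvalue distribution `m_N`: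
    (Mm : ℕ → ℕ → Ω → ℝ)
    (hMm : ∀ n k ω, Mm n k ω = (1 / (n + 1 : ℝ)) * ∑ i, lam n ω i ^ k)
    (hint : ∀ n k, Integrable (Mm n k) Pr)
    -- `sup_{N ≥ 1} E[M_k(m_N)] < ∞` for every even `k`:
    (hsup : ∀ k : ℕ, Even k → ∃ C : ℝ, ∀ n, (∫ ω, Mm n k ω ∂Pr) ≤ C)
    -- the free cumulants of `m_N`, characterized by the moment–cumulant formula:
    (fc : ℕ → ℕ → Ω → ℝ)
    (hfc : ∀ n, ∀ k : ℕ, 1 ≤ k → ∀ ω,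
      Mm n k ω = ∑ ρ ∈ NCFinset k, ∏ B ∈ ρ, fc n B.card ω)
    -- the moments of the Rayleigh measure `κ_N`:
    (Mκ : ℕ → ℕ → Ω → ℝ)
    (hMκ : ∀ n k ω, Mκ n k ω = (∑ i, lam n ω i ^ k) - ∑ j, lamt n ω j ^ k)
    -- `M_k(τ_N) = Σ_{ρ ∈ NC(k)} (k+1−|ρ|) fc_ρ(m_N)`:
    (Mτ : ℕ → ℕ → Ω → ℝ)
    (hMτ : ∀ n k ω, Mτ n k ω
      = ∑ ρ ∈ NCFinset k, ((k : ℝ) + 1 - ρ.card) * ∏ B ∈ ρ, fc n B.card ω)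
    (k : ℕ) (hk : 1 ≤ k) :
    ∃ C : ℝ, ∀ n : ℕ,
      |(∫ ω, (Mκ n k ω) ^ 2 ∂Pr) - ∫ ω, (Mτ n k ω) ^ 2 ∂Pr| ≤ C / (n + 1) := by
  have hrow : ∀ n, IsHaarRow Pr fun ω => U n ω (Fin.last n) := fun n =>
    isHaarRow_of_isHaarMeasure (hUmeas n) (hUuni n) (hHaar n) (Fin.last n)
  have hind : ∀ n, IndepFun (fun ω => U n ω (Fin.last n)) (D n) Pr := fun n =>
    (hindep n).comp (φ := fun A : Matrix (Fin (n + 1)) (Fin (n + 1)) ℂ => A (Fin.last n)) (ψ := id) (measurable_pi_apply (Fin.last n))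
      measurable_id
  have hMmD : ∀ n j ω, Mm n j ω = 1 / ((n : ℝ) + 1) * ∑ a, D n ω a ^ j := by
    intro n j ω
    obtain ⟨V, hV, hXV⟩ := hlam_eig n ω
    have h1 := trace_conj_diagonal_pow (hUuni n ω) (D n ω) j
    rw [← hX, hXV, trace_conj_diagonal_pow hV] at h1
    rw [hMm, Complex.ofReal_injective h1]
  have hκ : ∀ n ω, IsNewtonPair
      (fun j => ∑ a, Complex.normSq (U n ω (Fin.last n) a) * D n ω a ^ j)
      (fun j => Mκ n j ω) := by
    intro n ω
    obtain ⟨V, hV, hXV⟩ := hlam_eig n ω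
    obtain ⟨W, hW, hXW⟩ := hlamt_eig n ω
    simp only [hMκ]
    exact isNewtonPair_corner (hUuni n ω) hV hW (hX n ω) hXV hXW
  have hτ : ∀ (n : ℕ) ω, IsNewtonPair (fun j => 1 / ((n : ℝ) + 1) * ∑ a, D n ω a ^ j)
      (fun j => Mτ n j ω) := by
    intro n ω
    simp only [← hMmD]
    refine isNewtonPair_freeCumulant _ _ (fun j => fc n j ω) ?_ (fun k hk => hfc n k hk ω)
      fun k => hMτ n k ω
    rw [hMm]
    simp
    field_simp
  obtain ⟨l, rfl⟩ : ∃ l, k = l + 1 := ⟨k - 1, by omega⟩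
  obtain ⟨f, hf, hfy⟩ := exists_weightedPolys_of_isNewtonPair l
  have hff := mul_mem_weightedPolys hf hf
  rw [← two_mul] at hff
  obtain ⟨B, hB⟩ := hsup (2 * (l + 1)) (even_two_mul _)
  simp only [hMmD] at hB
  obtain ⟨C, hC⟩ := exists_abs_integral_sub_le hrow hDmeas hind hk (fun n => by
    have h1 := (hint n (2 * (l + 1))).const_mul ((n : ℝ) + 1)
    refine h1.congr (Filter.Eventually.of_forall fun ω => ?_)
    simp only [hMmD]
    field_simp) hB hff
  refine ⟨C, fun n => ?_⟩
  have h1 := (hC n).2.2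
  simp only [Pi.mul_apply, ← hfy _ _ (hκ n _), ← hfy _ _ (hτ n _), ← sq] at h1
  exact h1
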